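/- arXiv:1008.4076 — 2 statements merged into one kernel-verified Lean document; each statement's English description precedes it below -/
import Mathlib

section
/- Let A be a k-algebra, h > 1 a divisor of n, and g_l : A → A (0 ≤ l < n/h) k-linear maps with g_l(1) = 0. Assume g_0^h = 0, there exists x ∈ A with q := g_0^{h-1}(x) invertible, B := ker g_0 is a k-subalgebra of the center of A, and each g_l is B-linear. Then there exists a unique twisting map s : C⊗A → A⊗C with C = k[y]/⟨y^n⟩ such that γ^1_{lh} = g_l for all l, and moreover s(c⊗b) = b⊗c for all c ∈ C and b ∈ B. -/
open TensorProduct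

/-- A twisting map `s : C ⊗ A → A ⊗ C`. -/
def IsTwistingMap (k A C : Type*) [CommRing k] [Ring A] [Ring C] [Algebra k A]
    [Algebra k C] (s : C ⊗[k] A →ₗ[k] A ⊗[k] C) : Prop :=
  (∀ a : A, s ((1 : C) ⊗ₜ[k] a) = a ⊗ₜ[k] (1 : C)) ∧
  (∀ c : C, s (c ⊗ₜ[k] (1 : A)) = (1 : A) ⊗ₜ[k] c) ∧
  (∀ (c c' : C) (a : A), s ((c * c') ⊗ₜ[k] a) =
    (LinearMap.lTensor A (LinearMap.mul' k C))
      ((TensorProduct.assoc k A C C)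
        ((LinearMap.rTensor C s)
          ((TensorProduct.assoc k C A C).symm (c ⊗ₜ[k] (s (c' ⊗ₜ[k] a))))))) ∧
  (∀ (c : C) (a a' : A), s (c ⊗ₜ[k] (a * a')) =
    (LinearMap.rTensor C (LinearMap.mul' k A))
      ((TensorProduct.assoc k A A C).symm
        ((LinearMap.lTensor A s)
          ((TensorProduct.assoc k A C A)
            ((LinearMap.rTensor A s) ((c ⊗ₜ[k] a) ⊗ₜ[k] a'))))))
/-- The truncated polynomial algebra `k[y]/⟨y^n⟩`. -/
abbrev TruncPoly (k : Type*) [CommRing k] (n : ℕ) : Type _ :=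
  Polynomial k ⧸ Ideal.span {(Polynomial.X : Polynomial k) ^ n}

/-- The class of `y` in `k[y]/⟨y^n⟩`. -/
noncomputable def truncY (k : Type*) [CommRing k] (n : ℕ) : TruncPoly k n :=
  Ideal.Quotient.mk _ Polynomial.X


namespace TruncatedTwist

open PowerSeries Finset.HasAntidiagonal

noncomputable section

theorem sum_range_sum_range_eq_sum_antidiagonal {V : Type*} [AddCommMonoid V] (n : ℕ)
    (f : ℕ → ℕ → V) (hf : ∀ i j, n ≤ i + j → f i j = 0) :
    ∑ i ∈ Finset.range n, ∑ j ∈ Finset.range n, f i j =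
      ∑ q ∈ Finset.range n, ∑ ij ∈ antidiagonal q, f ij.1 ij.2 := by
  simp_rw [Finset.Nat.sum_antidiagonal_eq_sum_range_succ f, Nat.succ_eq_add_one]
  rw [Finset.sum_range_diag_flip]
  refine Finset.sum_congr rfl fun i _ => ?_
  symm
  refine Finset.sum_subset (Finset.range_mono (Nat.sub_le n i)) fun j _ hj => hf i j ?_
  rw [Finset.mem_range] at hj
  omega

/-- The two-sided ideal of power series of order at least `p`. -/
def lowIdeal (R : Type*) [Ring R] (p : ℕ) : Ideal R⟦X⟧ where
  carrier := {f | ∀ q < p, coeff q f = 0}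
  zero_mem' := fun q _ => by simp
  add_mem' := fun {f g} hf hg q hq => by simp [hf q hq, hg q hq]
  smul_mem' := fun c f hf q hq => by
    rw [smul_eq_mul, coeff_mul]
    refine Finset.sum_eq_zero fun ij hij => ?_
    rw [mem_antidiagonal] at hij
    rw [hf _ (by omega), mul_zero]

instance (R : Type*) [Ring R] (p : ℕ) : (lowIdeal R p).IsTwoSided where
  mul_mem_of_left := fun {f} g hf q hq => by
    rw [coeff_mul]
    refine Finset.sum_eq_zero fun ij hij => ?_
    rw [mem_antidiagonal] at hij
    rw [hf _ (by omega), zero_mul]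

/-- Reduction of power series modulo terms of degree at least `p`. -/
abbrev red (R : Type*) [Ring R] (p : ℕ) : R⟦X⟧ →+* R⟦X⟧ ⧸ lowIdeal R p :=
  Ideal.Quotient.mk (lowIdeal R p)

theorem red_eq_red {R : Type*} [Ring R] {p : ℕ} {f g : R⟦X⟧} :
    red R p f = red R p g ↔ ∀ q < p, coeff q f = coeff q g := by
  rw [Ideal.Quotient.eq]
  refine forall₂_congr fun q _ => ?_
  rw [map_sub, sub_eq_zero]

theorem red_eq_zero {R : Type*} [Ring R] {p : ℕ} {f : R⟦X⟧} :
    red R p f = 0 ↔ ∀ q < p, coeff q f = 0 := by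
  rw [← map_zero (red R p), red_eq_red]
  simp

theorem coeff_mul_of_lt_right {R : Type*} [Ring R] {p : ℕ} (f : R⟦X⟧) {g : R⟦X⟧}
    (hg : ∀ q < p, coeff q g = 0) : coeff p (f * g) = coeff 0 f * coeff p g := by
  rw [coeff_mul]
  refine Finset.sum_eq_single (0, p) (fun ij hij hne => ?_) (fun hp => ?_)
  · rw [mem_antidiagonal] at hij
    have : ij.2 < p := by
      by_contra hlt
      exact hne (Prod.ext (by simp; omega) (by simp; omega))
    rw [hg _ this, mul_zero]
  · simp at hp

theorem coeff_mul_of_lt_left {R : Type*} [Ring R] {p : ℕ} {f : R⟦X⟧} (g : R⟦X⟧)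
    (hf : ∀ q < p, coeff q f = 0) : coeff p (f * g) = coeff p f * coeff 0 g := by
  rw [coeff_mul]
  refine Finset.sum_eq_single (p, 0) (fun ij hij hne => ?_) (fun hp => ?_)
  · rw [mem_antidiagonal] at hij
    have : ij.1 < p := by
      by_contra hlt
      exact hne (Prod.ext (by simp; omega) (by simp; omega))
    rw [hf _ this, zero_mul]
  · simp at hp

variable {k A : Type*} [CommRing k] [Ring A] [Algebra k A]

theorem end_pow_apply_mul {g : Module.End k A} {b : A} (hg : ∀ a, g (a * b) = g a * b) (m : ℕ)
    (a : A) : (g ^ m) (a * b) = (g ^ m) a * b := by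
  induction m with
  | zero => simp
  | succ m ih => rw [pow_succ', Module.End.mul_apply, ih, hg, Module.End.mul_apply]

/-- A sequence `e 0 = 1, e 1, …, e (h - 1)` which `g` shifts down, with `g 1 = 0`. -/
structure IsJordanChain (g : Module.End k A) (h : ℕ) (e : ℕ → A) : Prop where
  zero : e 0 = 1
  map_one : g 1 = 0
  map_succ : ∀ m, m + 1 < h → g (e (m + 1)) = e m

namespace IsJordanChain

variable {g : Module.End k A} {h : ℕ} {e : ℕ → A}

theorem pow_apply (H : IsJordanChain g h e) (i : ℕ) {m : ℕ} (hm : m < h) :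
    (g ^ i) (e m) = if i ≤ m then e (m - i) else 0 := by
  induction i with
  | zero => simp
  | succ i ih =>
    rw [pow_succ', Module.End.mul_apply, ih]
    split_ifs with h1 h2 h2
    · obtain ⟨d, rfl⟩ := Nat.exists_eq_add_of_le h2
      rw [show i + 1 + d - i = d + 1 by omega, H.map_succ d (by omega),
        show i + 1 + d - (i + 1) = d by omega]
    · rw [show m - i = 0 by omega, H.zero, H.map_one]
    · omega
    · exact _root_.map_zero g

theorem sum_mul_pow_apply (H : IsJordanChain g h e) (c : ℕ → A) {m : ℕ} (hm : m < h) :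
    ∑ i ∈ Finset.range h, c i * (g ^ i) (e m) =
      ∑ ij ∈ antidiagonal m, c ij.1 * e ij.2 := by
  rw [Finset.Nat.sum_antidiagonal_eq_sum_range_succ (fun i j => c i * e j), eq_comm]
  refine Finset.sum_subset_zero_on_sdiff (Finset.range_mono hm) (fun i hi => ?_) fun i hi => ?_
  · simp only [Finset.mem_sdiff, Finset.mem_range, Nat.succ_eq_add_one] at hi
    rw [H.pow_apply i hm, if_neg (by omega), mul_zero]
  · rw [Finset.mem_range] at hi
    rw [H.pow_apply i hm, if_pos (by omega)]

theorem eq_zero_of_sum_mul_pow (H : IsJordanChain g h e) {c : ℕ → A}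
    (hc : ∀ m < h, ∑ i ∈ Finset.range h, c i * (g ^ i) (e m) = 0) : ∀ m < h, c m = 0 := by
  intro m
  induction m using Nat.strong_induction_on with
  | _ m ih =>
    intro hm
    have := hc m hm
    rw [H.sum_mul_pow_apply c hm, Finset.sum_eq_single (m, 0)] at this
    · simpa [H.zero] using this
    · intro ij hij hne
      rw [mem_antidiagonal] at hij
      have : ij.1 < m := by
        by_contra hlt
        exact hne (Prod.ext (by simp; omega) (by simp; omega))
      rw [ih _ this (by omega), zero_mul]
    · simp

theorem map (H : IsJordanChain g h e) {W : Module.End k A} (hW : W 1 = 1)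
    (hWg : g * W = W * g) : IsJordanChain g h (fun m => W (e m)) where
  zero := by rw [H.zero, hW]
  map_one := H.map_one
  map_succ m hm := by
    rw [← Module.End.mul_apply, hWg, Module.End.mul_apply, H.map_succ m hm]

/-- Maps that are linear over the central subalgebra `ker g` are determined by their values
on a Jordan chain. -/
theorem hom_ext (H : IsJordanChain g h e) (hg : g ^ h = 0)
    (hlin : ∀ a b, g b = 0 → g (a * b) = g a * b)
    {φ ψ : Module.End k A} (hφ : ∀ a b, g b = 0 → φ (a * b) = φ a * b)
    (hψ : ∀ a b, g b = 0 → ψ (a * b) = ψ a * b) (heq : ∀ m < h, φ (e m) = ψ (e m)) :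
    φ = ψ := by
  have key : ∀ m ≤ h, ∀ a, (g ^ m) a = 0 → φ a = ψ a := by
    intro m
    induction m with
    | zero =>
      intro _ a ha
      rw [pow_zero, Module.End.one_apply] at ha
      rw [ha, _root_.map_zero, _root_.map_zero]
    | succ m ih =>
      intro hm a ha
      have hb : g ((g ^ m) a) = 0 := by rwa [pow_succ', Module.End.mul_apply] at ha
      have := ih (by omega) (a - e m * (g ^ m) a) (by
        rw [map_sub, end_pow_apply_mul (fun a => hlin a _ hb), H.pow_apply m (by omega),
          if_pos le_rfl, Nat.sub_self, H.zero, one_mul, sub_self])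
      rw [map_sub, map_sub, hφ _ _ hb, hψ _ _ hb, heq m (by omega)] at this
      exact sub_left_injective this
  ext a
  exact key h le_rfl a (by rw [hg, LinearMap.zero_apply])

end IsJordanChain

variable (k A) in
/-- Left multiplications, as constant power series of endomorphisms. -/
def leftMul : A →+* (Module.End k A)⟦X⟧ :=
  (PowerSeries.C).comp (Algebra.lmul k A).toRingHom

theorem coeff_leftMul_mul (a : A) (f : (Module.End k A)⟦X⟧) (q : ℕ) (b : A) :
    coeff q (leftMul k A a * f) b = a * coeff q f b := by
  simp [leftMul, coeff_C_mul]

theorem coeff_mul_leftMul (a : A) (f : (Module.End k A)⟦X⟧) (q : ℕ) (b : A) :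
    coeff q (f * leftMul k A a) b = coeff q f (a * b) := by
  simp [leftMul, coeff_mul_C]

theorem coeff_sum_leftMul_mul (s : Finset ℕ) (c : ℕ → A) (f : ℕ → (Module.End k A)⟦X⟧) (q : ℕ)
    (b : A) : coeff q (∑ j ∈ s, leftMul k A (c j) * f j) b = ∑ j ∈ s, c j * coeff q (f j) b := by
  simp [map_sum, LinearMap.sum_apply, coeff_leftMul_mul]

/-- The commutation rule of `y` with the image of `A` determines that of the powers of `y`. -/
theorem pow_mul_eq_sum {Q : Type*} [Ring Q] (ι : A →+* Q) (y : Q) (M : (Module.End k A)⟦X⟧)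
    {n : ℕ} (hn : 0 < n) (hy : y ^ n = 0)
    (hM : ∀ a, y * ι a = ∑ j ∈ Finset.range n, ι (coeff j M a) * y ^ j) (r : ℕ) (a : A) :
    y ^ r * ι a = ∑ j ∈ Finset.range n, ι (coeff j (M ^ r) a) * y ^ j := by
  induction r with
  | zero =>
    rw [Finset.sum_eq_single 0]
    · simp
    · intro j _ hj
      simp [PowerSeries.coeff_one, hj]
    · simp [hn.ne']
  | succ r ih =>
    rw [pow_succ', mul_assoc, ih, Finset.mul_sum]
    simp_rw [← mul_assoc, hM, Finset.sum_mul]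
    rw [Finset.sum_comm, sum_range_sum_range_eq_sum_antidiagonal]
    · refine Finset.sum_congr rfl fun q _ => ?_
      rw [pow_succ', coeff_mul, LinearMap.sum_apply, map_sum, Finset.sum_mul]
      refine Finset.sum_congr rfl fun ij hij => ?_
      rw [mem_antidiagonal] at hij
      rw [mul_assoc, ← pow_add, hij, Module.End.mul_apply]
    · intro i j hij
      rw [mul_assoc, ← pow_add, pow_eq_zero_of_le hij hy, mul_zero]

/-- The conditions on `∑ γ_j X^j` for `y a = ∑ γ_j(a) y^j` to define a twisting map with
`y^n = 0`. -/
structure IsTwistSeries (n : ℕ) (M : (Module.End k A)⟦X⟧) : Prop where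
  map_one : ∀ q < n, coeff q M 1 = if q = 1 then 1 else 0
  pow_eq_zero : ∀ q < n, coeff q (M ^ n) = 0
  mul_eq : ∀ a, ∀ q < n, coeff q (M * leftMul k A a) =
    coeff q (∑ j ∈ Finset.range n, leftMul k A (coeff j M a) * M ^ j)

theorem coeff_pow_apply_one {p : ℕ} {M : (Module.End k A)⟦X⟧}
    (hM : ∀ q < p, coeff q M 1 = if q = 1 then 1 else 0) (r : ℕ) :
    ∀ q < p, coeff q (M ^ r) 1 = if q = r then 1 else 0 := by
  induction r with
  | zero =>
    intro q _
    rw [pow_zero, PowerSeries.coeff_one]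
    split_ifs <;> simp
  | succ r ih =>
    intro q hq
    rw [pow_succ, coeff_mul, LinearMap.sum_apply]
    rcases q with _ | q
    · rw [Finset.Nat.antidiagonal_zero, Finset.sum_singleton, Module.End.mul_apply, hM 0 hq]
      simp
    · rw [Finset.sum_eq_single (q, 1)]
      · rw [Module.End.mul_apply, hM 1 (by omega), if_pos rfl, ih q (by omega)]
        simp
      · intro ij hij hne
        rw [mem_antidiagonal] at hij
        have : ij.2 ≠ 1 := fun h1 => hne (Prod.ext (by simp; omega) (by simp; omega))
        rw [Module.End.mul_apply, hM _ (by omega), if_neg this, _root_.map_zero]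
      · simp

theorem coeff_pow_mul_right {M : (Module.End k A)⟦X⟧} {b : A}
    (hM : ∀ j a, coeff j M (a * b) = coeff j M a * b) (r : ℕ) :
    ∀ j a, coeff j (M ^ r) (a * b) = coeff j (M ^ r) a * b := by
  induction r with
  | zero =>
    intro j a
    rw [pow_zero, PowerSeries.coeff_one]
    split_ifs <;> simp
  | succ r ih =>
    intro j a
    rw [pow_succ, coeff_mul, LinearMap.sum_apply, LinearMap.sum_apply, Finset.sum_mul]
    refine Finset.sum_congr rfl fun ij _ => ?_
    rw [Module.End.mul_apply, Module.End.mul_apply, hM, ih]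

variable (k A) in
/-- Left multiplications, as constant power series modulo terms of degree at least `p`. -/
def lowMul (p : ℕ) : A →+* (Module.End k A)⟦X⟧ ⧸ lowIdeal (Module.End k A) p :=
  (red _ p).comp (leftMul k A)

theorem sum_lowMul_mul_pow (p : ℕ) (s : Finset ℕ) (c : ℕ → A) (M : (Module.End k A)⟦X⟧) :
    ∑ j ∈ s, lowMul k A p (c j) * red _ p M ^ j =
      red _ p (∑ j ∈ s, leftMul k A (c j) * M ^ j) := by
  simp [lowMul]

theorem coeff_zero_pow {R : Type*} [Ring R] (M : R⟦X⟧) (i : ℕ) :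
    coeff 0 (M ^ i) = coeff 0 M ^ i := by
  simp

section

variable {p h : ℕ} {M : (Module.End k A)⟦X⟧} {e : ℕ → A}

theorem isJordanChain_leadingCoeff (H : IsJordanChain (coeff 0 M) h e)
    (hM : ∀ q < p + 1, coeff q M 1 = if q = 1 then 1 else 0)
    (hp : ∀ q < p, coeff q (M ^ p) = 0) :
    IsJordanChain (coeff 0 M) h (fun m => coeff p (M ^ p) (e m)) := by
  refine H.map ?_ ?_
  · rw [coeff_pow_apply_one hM p p (Nat.lt_succ_self p), if_pos rfl]
  · rw [← coeff_mul_of_lt_right M hp, ← coeff_mul_of_lt_left M hp, ← pow_succ, ← pow_succ']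

theorem coeff_pow_add (hp : ∀ q < p, coeff q (M ^ p) = 0) (i : ℕ) :
    coeff p (M ^ (p + i)) = coeff 0 M ^ i * coeff p (M ^ p) := by
  rw [add_comm, pow_add, coeff_mul_of_lt_right _ hp, coeff_zero_pow]

theorem coeff_pow_eq_zero_of_le {R : Type*} [Ring R] {p r : ℕ} {M : R⟦X⟧}
    (hp : ∀ q < p, coeff q (M ^ p) = 0) (hr : p ≤ r) : ∀ q < p, coeff q (M ^ r) = 0 := by
  rw [← red_eq_zero, map_pow] at hp ⊢
  exact pow_eq_zero_of_le hr hp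

theorem red_pow_add_eq_zero (hg : (coeff 0 M) ^ h = 0) (hp : ∀ q < p, coeff q (M ^ p) = 0) :
    red _ (p + 1) M ^ (p + h) = 0 := by
  rw [← map_pow, red_eq_zero]
  intro q hq
  rcases Nat.lt_succ_iff_lt_or_eq.1 hq with hq | rfl
  · exact coeff_pow_eq_zero_of_le hp (Nat.le_add_right p h) q hq
  · rw [coeff_pow_add hp, hg, zero_mul]

/-- Powers of `M` below `p + h` are left independent over `A`, modulo degree `p + 1`. -/
theorem eq_zero_of_sum_lowMul (H : IsJordanChain (coeff 0 M) h e)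
    (hM : ∀ q < p + 1, coeff q M 1 = if q = 1 then 1 else 0)
    (hp : ∀ q < p, coeff q (M ^ p) = 0) {c : ℕ → A}
    (hc : ∑ j ∈ Finset.range (p + h), lowMul k A (p + 1) (c j) * red _ (p + 1) M ^ j = 0) :
    ∀ j < p + h, c j = 0 := by
  rw [sum_lowMul_mul_pow, red_eq_zero] at hc
  have hlow : ∀ q < p, c q = 0 := by
    intro q hq
    have h1 := LinearMap.congr_fun (hc q (by omega)) 1
    rw [coeff_sum_leftMul_mul, Finset.sum_eq_single q] at h1
    · rw [coeff_pow_apply_one hM q q (by omega)] at h1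
      simpa using h1
    · intro j _ hj
      rw [coeff_pow_apply_one hM j q (by omega), if_neg hj.symm, mul_zero]
    · intro hq'
      exact absurd (Finset.mem_range.2 (by omega)) hq'
  have hhigh : ∀ m < h, c (p + m) = 0 := by
    refine (isJordanChain_leadingCoeff H hM hp).eq_zero_of_sum_mul_pow
      (c := fun m => c (p + m)) fun m _ => ?_
    have h1 := LinearMap.congr_fun (hc p (Nat.lt_succ_self p)) (e m)
    rw [coeff_sum_leftMul_mul, Finset.sum_range_add, Finset.sum_eq_zero, zero_add] at h1
    · simpa only [coeff_pow_add hp, Module.End.mul_apply, LinearMap.zero_apply] using h1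
    · intro j hj
      rw [hlow j (Finset.mem_range.1 hj), zero_mul]
  intro j hj
  rcases lt_or_ge j p with hjp | hjp
  · exact hlow j hjp
  · obtain ⟨d, rfl⟩ := Nat.exists_eq_add_of_le hjp
    exact hhigh d (by omega)

theorem eq_of_sum_lowMul (H : IsJordanChain (coeff 0 M) h e)
    (hM : ∀ q < p + 1, coeff q M 1 = if q = 1 then 1 else 0)
    (hp : ∀ q < p, coeff q (M ^ p) = 0) {c d : ℕ → A}
    (hc : ∑ j ∈ Finset.range (p + h), lowMul k A (p + 1) (c j) * red _ (p + 1) M ^ j =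
      ∑ j ∈ Finset.range (p + h), lowMul k A (p + 1) (d j) * red _ (p + 1) M ^ j) :
    ∀ j < p + h, c j = d j := by
  intro j hj
  rw [← sub_eq_zero]
  refine eq_zero_of_sum_lowMul (c := fun j => c j - d j) H hM hp ?_ j hj
  simp_rw [map_sub, sub_mul, Finset.sum_sub_distrib, hc, sub_self]

/-- The commutation rule modulo degree `p + 1` already implies all twisting conditions up to
degree `p + h`. -/
theorem isTwistSeries_of_low (hh : 1 < h) (H : IsJordanChain (coeff 0 M) h e)
    (hg : (coeff 0 M) ^ h = 0)
    (hM : ∀ q < p + 1, coeff q M 1 = if q = 1 then 1 else 0)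
    (hp : ∀ q < p, coeff q (M ^ p) = 0)
    (hmul : ∀ a, red _ (p + 1) M * lowMul k A (p + 1) a = ∑ j ∈ Finset.range (p + h),
      lowMul k A (p + 1) (coeff j M a) * red _ (p + 1) M ^ j) :
    IsTwistSeries (p + h) M := by
  have hy := red_pow_add_eq_zero hg hp
  have hpow := pow_mul_eq_sum (lowMul k A (p + 1)) (red _ (p + 1) M) M (by omega) hy hmul
  refine ⟨?_, ?_, ?_⟩
  · refine eq_of_sum_lowMul (d := fun j => if j = 1 then 1 else 0) H hM hp ?_
    rw [← hmul, Finset.sum_eq_single 1]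
    · simp
    · intro j _ hj
      simp [hj]
    · intro h1
      exact absurd (Finset.mem_range.2 (by omega)) h1
  · intro q hq
    ext a
    refine eq_zero_of_sum_lowMul (c := fun j => coeff j (M ^ (p + h)) a) H hM hp ?_ q hq
    rw [← hpow, hy, zero_mul]
  · intro a q hq
    ext b
    rw [coeff_mul_leftMul, coeff_sum_leftMul_mul]
    refine eq_of_sum_lowMul (c := fun j => coeff j M (a * b))
      (d := fun q => ∑ j ∈ Finset.range (p + h), coeff j M a * coeff q (M ^ j) b)
      H hM hp ?_ q hq
    rw [← hmul, map_mul, ← mul_assoc, hmul, Finset.sum_mul]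
    simp_rw [mul_assoc, hpow, map_sum, Finset.sum_mul, Finset.mul_sum]
    rw [Finset.sum_comm]
    simp_rw [map_mul, mul_assoc]

end

theorem exists_left_inverse_sequence {f : ℕ → A} (hf : f 0 = 1) :
    ∃ F : ℕ → A, ∀ (d : ℕ → A) (m : ℕ),
      ∑ ij ∈ antidiagonal m, (∑ uv ∈ antidiagonal ij.1, d uv.1 * F uv.2) * f ij.2 = d m := by
  refine ⟨fun v => coeff v (invOfUnit (mk f) 1), fun d m => ?_⟩
  have h1 : mk d * invOfUnit (mk f) 1 * mk f = mk d := by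
    rw [mul_assoc, invOfUnit_mul, mul_one]
    simp [hf]
  have h2 := congrArg (coeff m) h1
  simpa only [coeff_mul, coeff_mk] using h2

theorem IsTwistSeries.extend {g₀ : Module.End k A} {p h : ℕ} {e : ℕ → A} (hh : 1 < h)
    (H : IsJordanChain g₀ h e) (hg : g₀ ^ h = 0)
    (hcomm : ∀ b, g₀ b = 0 → ∀ a : A, a * b = b * a)
    (hlin₀ : ∀ a b, g₀ b = 0 → g₀ (a * b) = g₀ a * b)
    {M : (Module.End k A)⟦X⟧} (hT : IsTwistSeries p M)
    (hlin : ∀ b, g₀ b = 0 → ∀ j a, coeff j M (a * b) = coeff j M a * b)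
    {G : Module.End k A} (hG : G 1 = 0) (hp1 : p ≠ 1)
    (hGlin : ∀ a b, g₀ b = 0 → G (a * b) = G a * b)
    (hM₀ : 0 < p → coeff 0 M = g₀) (hG₀ : p = 0 → G = g₀) :
    ∃ M' : (Module.End k A)⟦X⟧, IsTwistSeries (p + h) M' ∧
      (∀ b, g₀ b = 0 → ∀ j a, coeff j M' (a * b) = coeff j M' a * b) ∧
      (∀ j < p, coeff j M' = coeff j M) ∧ coeff p M' = G := by
  set N : (Module.End k A)⟦X⟧ :=
    PowerSeries.mk fun j => if j < p then coeff j M else if j = p then G else 0 with hN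
  have hNlt : ∀ j < p, coeff j N = coeff j M := fun j hj => by rw [hN, coeff_mk, if_pos hj]
  have hNp : coeff p N = G := by simp [hN]
  have hN₀ : coeff 0 N = g₀ := by
    rcases Nat.eq_zero_or_pos p with h0 | h0
    · rw [← hG₀ h0, ← hNp, h0]
    · rw [hNlt 0 h0, hM₀ h0]
  have hN1 : ∀ q < p + 1, coeff q N 1 = if q = 1 then 1 else 0 := by
    intro q hq
    rcases Nat.lt_succ_iff_lt_or_eq.1 hq with hq | rfl
    · rw [hNlt q hq, hT.map_one q hq]
    · rw [hNp, hG, if_neg hp1]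
  have hNM : red _ p N = red _ p M := red_eq_red.2 hNlt
  have hNpow : ∀ q < p, coeff q (N ^ p) = 0 := by
    rw [← red_eq_zero, map_pow, hNM, ← map_pow, red_eq_zero]
    exact hT.pow_eq_zero
  have hNlin : ∀ b, g₀ b = 0 → ∀ j a, coeff j N (a * b) = coeff j N a * b := by
    intro b hb j a
    rw [hN, coeff_mk]
    split_ifs
    · exact hlin b hb j a
    · exact hGlin a b hb
    · simp
  have HN : IsJordanChain (coeff 0 N) h e := hN₀.symm ▸ H
  have HW := isJordanChain_leadingCoeff HN hN1 hNpow
  obtain ⟨F, hF⟩ := exists_left_inverse_sequence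
    (f := fun m => coeff p (N ^ p) (e m)) HW.zero
  -- the degree `p` defect of the commutation rule, as a function of its left argument
  let Ψ : A → Module.End k A := fun b => G ∘ₗ LinearMap.mulRight k b -
    ∑ j ∈ Finset.range p, LinearMap.mulRight k (coeff p (N ^ j) b) ∘ₗ coeff j M
  have hΨ : ∀ a b, Ψ b a =
      G (a * b) - ∑ j ∈ Finset.range p, coeff j M a * coeff p (N ^ j) b := by
    intro a b
    simp [Ψ, LinearMap.sum_apply]
  have hΨlin : ∀ a b c, g₀ c = 0 → Ψ b (a * c) = Ψ b a * c := by
    intro a b c hc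
    rw [hΨ, hΨ, mul_assoc, ← hcomm c hc b, ← mul_assoc, hGlin _ _ hc, sub_mul, Finset.sum_mul]
    congr 1
    refine Finset.sum_congr rfl fun j _ => ?_
    rw [hlin c hc, mul_assoc, ← hcomm c hc, mul_assoc]
  let T : ℕ → Module.End k A := fun i =>
    ∑ uv ∈ antidiagonal i, LinearMap.mulRight k (F uv.2) ∘ₗ Ψ (e uv.1)
  have hT_apply : ∀ i a, T i a = ∑ uv ∈ antidiagonal i, Ψ (e uv.1) a * F uv.2 := by
    intro i a
    simp [T, LinearMap.sum_apply]
  have hTsum : ∀ a m, ∑ ij ∈ antidiagonal m, T ij.1 a * coeff p (N ^ p) (e ij.2) =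
      Ψ (e m) a := by
    intro a m
    simp_rw [hT_apply]
    exact hF (fun u => Ψ (e u) a) m
  have hT0 : T 0 = G := by
    ext a
    have h1 := hTsum a 0
    rw [Finset.Nat.antidiagonal_zero, Finset.sum_singleton, HW.zero, mul_one, hΨ, H.zero,
      mul_one, Finset.sum_eq_zero, sub_zero] at h1
    · exact h1
    · intro j hj
      rw [Finset.mem_range] at hj
      rw [coeff_pow_apply_one hN1 j p (Nat.lt_succ_self p), if_neg hj.ne', mul_zero]
  have hTlin : ∀ i a b, g₀ b = 0 → T i (a * b) = T i a * b := by
    intro i a b hb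
    rw [hT_apply, hT_apply, Finset.sum_mul]
    refine Finset.sum_congr rfl fun uv _ => ?_
    rw [hΨlin _ _ _ hb, mul_assoc, ← hcomm b hb, mul_assoc]
  set M' : (Module.End k A)⟦X⟧ :=
    PowerSeries.mk fun j => if j < p then coeff j M else T (j - p) with hM'
  have hM'lt : ∀ j < p, coeff j M' = coeff j M := fun j hj => by rw [hM', coeff_mk, if_pos hj]
  have hM'add : ∀ i, coeff (p + i) M' = T i := fun i => by simp [hM']
  have hM'p : coeff p M' = G := (hM'add 0).trans hT0
  have hred : red _ (p + 1) M' = red _ (p + 1) N := by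
    rw [red_eq_red]
    intro q hq
    rcases Nat.lt_succ_iff_lt_or_eq.1 hq with hq | rfl
    · rw [hM'lt q hq, hNlt q hq]
    · rw [hM'p, hNp]
  have hM'₀ : coeff 0 M' = coeff 0 N := red_eq_red.1 hred 0 (Nat.succ_pos p)
  refine ⟨M', ?_, ?_, hM'lt, hM'p⟩
  · refine isTwistSeries_of_low (e := e) hh (hM'₀.symm ▸ HN) (by rw [hM'₀, hN₀, hg]) ?_ ?_ ?_
    · intro q hq
      rw [red_eq_red.1 hred q hq, hN1 q hq]
    · rw [← red_eq_zero, map_pow, red_eq_red.2 hM'lt, ← map_pow, red_eq_zero]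
      exact hT.pow_eq_zero
    · intro a
      rw [hred, sum_lowMul_mul_pow, lowMul, RingHom.comp_apply, ← map_mul, red_eq_red]
      intro q hq
      rcases Nat.lt_succ_iff_lt_or_eq.1 hq with hq | rfl
      · ext b
        rw [coeff_mul_leftMul, coeff_sum_leftMul_mul, hNlt q hq, ← coeff_mul_leftMul,
          hT.mul_eq a q hq, coeff_sum_leftMul_mul, Finset.sum_range_add, eq_comm,
          add_eq_left.2]
        · refine Finset.sum_congr rfl fun j hj => ?_
          rw [hM'lt j (Finset.mem_range.1 hj)]
          have : red _ p (N ^ j) = red _ p (M ^ j) := by rw [map_pow, hNM, map_pow]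
          rw [red_eq_red.1 this q hq]
        · refine Finset.sum_eq_zero fun i _ => ?_
          rw [coeff_pow_eq_zero_of_le hNpow (Nat.le_add_right p i) q hq,
            LinearMap.zero_apply, mul_zero]
      · refine H.hom_ext hg hlin₀ ?_ ?_ ?_
        · intro b c hc
          rw [coeff_mul_leftMul, coeff_mul_leftMul, ← mul_assoc, hNlin c hc]
        · intro b c hc
          rw [coeff_sum_leftMul_mul, coeff_sum_leftMul_mul, Finset.sum_mul]
          refine Finset.sum_congr rfl fun j _ => ?_
          rw [coeff_pow_mul_right (hNlin c hc), mul_assoc]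
        · intro m hm
          rw [coeff_mul_leftMul, coeff_sum_leftMul_mul, Finset.sum_range_add, hNp,
            ← sub_eq_iff_eq_add']
          simp_rw [hM'add, coeff_pow_add hNpow, Module.End.mul_apply]
          rw [HW.sum_mul_pow_apply (fun i => T i a) hm, hTsum, hΨ]
          congr 1
          refine Finset.sum_congr rfl fun j hj => ?_
          rw [hM'lt j (Finset.mem_range.1 hj)]
  · intro b hb j a
    rw [hM', coeff_mk]
    split_ifs
    · exact hlin b hb j a
    · exact hTlin _ a b hb

theorem IsTwistSeries.exists_of_dvd {m h : ℕ} {e : ℕ → A} {g : ℕ → Module.End k A} (hh : 1 < h)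
    (H : IsJordanChain (g 0) h e) (hg : g 0 ^ h = 0)
    (hcomm : ∀ b, g 0 b = 0 → ∀ a : A, a * b = b * a)
    (hg1 : ∀ l < m, g l 1 = 0)
    (hlin : ∀ l < m, ∀ a b, g 0 b = 0 → g l (a * b) = g l a * b) :
    ∃ M : (Module.End k A)⟦X⟧, IsTwistSeries (m * h) M ∧
      (∀ b, g 0 b = 0 → ∀ j a, coeff j M (a * b) = coeff j M a * b) ∧
      ∀ l < m, coeff (l * h) M = g l := by
  induction m with
  | zero =>
    refine ⟨0, ⟨?_, ?_, ?_⟩, ?_, ?_⟩ <;> simp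
  | succ m ih =>
    obtain ⟨M, hT, hMlin, hM⟩ := ih (fun l hl => hg1 l (by omega)) fun l hl => hlin l (by omega)
    obtain ⟨M', hT', hMlin', hlt, heq⟩ := hT.extend hh H hg hcomm (hlin 0 (Nat.succ_pos m)) hMlin
      (hg1 m (Nat.lt_succ_self m)) (fun h1 => hh.ne' (Nat.eq_one_of_mul_eq_one_left h1))
      (hlin m (Nat.lt_succ_self m))
      (fun h0 => by
        have := hM 0 (Nat.pos_of_mul_pos_right h0)
        rwa [zero_mul] at this)
      (fun h0 => by rw [(Nat.mul_eq_zero.1 h0).resolve_right (by omega)])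
    refine ⟨M', by rwa [Nat.succ_mul], hMlin', fun l hl => ?_⟩
    rcases Nat.lt_succ_iff_lt_or_eq.1 hl with hl | rfl
    · rw [hlt _ (Nat.mul_lt_mul_of_pos_right hl (by omega)), hM l hl]
    · exact heq

theorem IsTwistSeries.red_mul {n p : ℕ} {M : (Module.End k A)⟦X⟧} (hT : IsTwistSeries n M)
    (hpn : p ≤ n) (a : A) : red _ p M * lowMul k A p a =
      ∑ j ∈ Finset.range n, lowMul k A p (coeff j M a) * red _ p M ^ j := by
  rw [sum_lowMul_mul_pow, lowMul, RingHom.comp_apply, ← map_mul, red_eq_red]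
  exact fun q hq => hT.mul_eq a q (by omega)

theorem IsTwistSeries.red_pow {n p : ℕ} {M : (Module.End k A)⟦X⟧} (hT : IsTwistSeries n M)
    (hpn : p ≤ n) : red _ p M ^ n = 0 := by
  rw [← map_pow, red_eq_zero]
  exact fun q hq => hT.pow_eq_zero q (by omega)

theorem IsTwistSeries.red_pow_mul {n p : ℕ} {M : (Module.End k A)⟦X⟧} (hT : IsTwistSeries n M)
    (hn : 0 < n) (hpn : p ≤ n) (r : ℕ) (a : A) : red _ p M ^ r * lowMul k A p a =
      ∑ j ∈ Finset.range n, lowMul k A p (coeff j (M ^ r) a) * red _ p M ^ j :=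
  pow_mul_eq_sum (lowMul k A p) (red _ p M) M hn (hT.red_pow hpn) (hT.red_mul hpn) r a

theorem sum_range_mul_pow_eq {Q : Type*} [Ring Q] {y : Q} {u n : ℕ} (hy : y ^ u = 0) (hu : u ≤ n)
    (c : ℕ → Q) :
    ∑ j ∈ Finset.range n, c j * y ^ j = ∑ j ∈ Finset.range u, c j * y ^ j := by
  symm
  refine Finset.sum_subset (Finset.range_mono hu) fun j _ hj => ?_
  rw [Finset.mem_range, not_lt] at hj
  rw [pow_eq_zero_of_le hj hy, mul_zero]

theorem IsTwistSeries.coeff_pow_eq_zero {n h : ℕ} {e : ℕ → A} {M : (Module.End k A)⟦X⟧}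
    (hT : IsTwistSeries n M) (hh : 1 < h) (hn : h ≤ n) (H : IsJordanChain (coeff 0 M) h e)
    (hg : (coeff 0 M) ^ h = 0) (l : ℕ) : ∀ q < l * h, coeff q (M ^ (l * h)) = 0 := by
  have hone : ∀ q < h, coeff q (M ^ h) = 0 := by
    intro q hq
    ext a
    have hy : red _ (0 + 1) M ^ (0 + h) = 0 := red_pow_add_eq_zero hg (by simp)
    refine eq_zero_of_sum_lowMul (p := 0) (c := fun j => coeff j (M ^ h) a) H
      (fun q hq => hT.map_one q (by omega)) (by simp) ?_ q (by omega)
    rw [← sum_range_mul_pow_eq (n := n) hy (by omega),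
      ← hT.red_pow_mul (p := 0 + 1) (by omega) (by omega)]
    rw [zero_add h] at hy
    rw [hy, zero_mul]
  induction l with
  | zero => simp
  | succ l ih =>
    intro q hq
    rw [Nat.succ_mul] at hq
    rw [Nat.succ_mul, pow_add, coeff_mul]
    refine Finset.sum_eq_zero fun ij hij => ?_
    rw [mem_antidiagonal] at hij
    rcases lt_or_ge ij.1 (l * h) with h1 | h1
    · rw [ih _ h1, zero_mul]
    · rw [hone ij.2 (by omega), mul_zero]

theorem IsTwistSeries.coeff_eq {m h : ℕ} {e : ℕ → A} {M M' : (Module.End k A)⟦X⟧} (hh : 1 < h)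
    (hT : IsTwistSeries (m * h) M) (hT' : IsTwistSeries (m * h) M')
    (H : IsJordanChain (coeff 0 M) h e) (hg : (coeff 0 M) ^ h = 0)
    (heq : ∀ l < m, coeff (l * h) M = coeff (l * h) M') :
    ∀ j < m * h, coeff j M = coeff j M' := by
  suffices hl : ∀ l ≤ m, ∀ j < l * h, coeff j M = coeff j M' from hl m le_rfl
  intro l
  induction l with
  | zero => simp
  | succ l ih =>
    intro hlm j hj
    rw [Nat.succ_mul] at hj
    have hle : l * h + h ≤ m * h := by
      rw [← Nat.succ_mul]
      exact Nat.mul_le_mul_right h hlm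
    have hp := hT.coeff_pow_eq_zero hh (by omega) H hg l
    have hred : red _ (l * h + 1) M = red _ (l * h + 1) M' := by
      rw [red_eq_red]
      intro q hq
      rcases Nat.lt_succ_iff_lt_or_eq.1 hq with hq | rfl
      · exact ih (by omega) q hq
      · exact heq l (by omega)
    have hy := red_pow_add_eq_zero hg hp
    ext a
    refine eq_of_sum_lowMul (c := fun j => coeff j M a) (d := fun j => coeff j M' a) H
      (fun q hq => hT.map_one q (by omega)) hp ?_ j hj
    rw [← sum_range_mul_pow_eq hy hle, ← sum_range_mul_pow_eq hy hle,
      ← hT.red_mul (by omega), hred, ← hT'.red_mul (by omega)]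

theorem IsTwistSeries.coeff_pow_mul {n : ℕ} {M : (Module.End k A)⟦X⟧} (hT : IsTwistSeries n M)
    (r : ℕ) (a b : A) {q : ℕ} (hq : q < n) : coeff q (M ^ r) (a * b) =
      ∑ j ∈ Finset.range n, coeff j (M ^ r) a * coeff q (M ^ j) b := by
  have h1 := hT.red_pow_mul (by omega) le_rfl r a
  rw [sum_lowMul_mul_pow, lowMul, RingHom.comp_apply, ← map_pow, ← map_mul, red_eq_red] at h1
  rw [← coeff_mul_leftMul, h1 q hq, coeff_sum_leftMul_mul]

theorem truncY_pow (k : Type*) [CommRing k] (n r : ℕ) :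
    truncY k n ^ r = Ideal.Quotient.mk _ (Polynomial.X ^ r) := by
  rw [truncY, map_pow]

theorem truncY_pow_eq_zero (k : Type*) [CommRing k] {n r : ℕ} (h : n ≤ r) :
    truncY k n ^ r = 0 := by
  rw [truncY_pow, Ideal.Quotient.eq_zero_iff_mem, Ideal.mem_span_singleton]
  exact pow_dvd_pow _ h

theorem truncPoly_induction {k : Type*} [CommRing k] {n : ℕ} {P : TruncPoly k n → Prop}
    (hadd : ∀ c d, P c → P d → P (c + d)) (hpow : ∀ (t : k) (r : ℕ), P (t • truncY k n ^ r))
    (c : TruncPoly k n) : P c := by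
  obtain ⟨f, rfl⟩ := Ideal.Quotient.mk_surjective c
  induction f using Polynomial.induction_on' with
  | add f g hf hg => rw [map_add]; exact hadd _ _ hf hg
  | monomial r t =>
    have := hpow t r
    rw [truncY_pow] at this
    rwa [← Polynomial.smul_X_eq_monomial]

/-- The coefficient of `y^j`, for `j < n`. -/
def truncCoeff (k : Type*) [CommRing k] (n j : ℕ) : TruncPoly k n →ₗ[k] k :=
  ((Ideal.span {(Polynomial.X : Polynomial k) ^ n}).restrictScalars k).liftQ
    (if j < n then Polynomial.lcoeff k j else 0) (by
      intro f hf
      rw [Submodule.restrictScalars_mem, Ideal.mem_span_singleton, Polynomial.X_pow_dvd_iff] at hf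
      rw [LinearMap.mem_ker]
      split_ifs with hj
      · exact hf j hj
      · rfl) ∘ₗ
  (Submodule.Quotient.restrictScalarsEquiv k
    (Ideal.span {(Polynomial.X : Polynomial k) ^ n})).symm.toLinearMap

theorem truncCoeff_pow (k : Type*) [CommRing k] {n j : ℕ} (hj : j < n) (r : ℕ) :
    truncCoeff k n j (truncY k n ^ r) = if j = r then 1 else 0 := by
  rw [truncY_pow]
  have : truncCoeff k n j (Ideal.Quotient.mk _ (Polynomial.X ^ r)) =
      (if j < n then Polynomial.lcoeff k j else 0) (Polynomial.X ^ r) := rfl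
  rw [this, if_pos hj, Polynomial.lcoeff_apply, Polynomial.coeff_X_pow]

theorem eq_of_sum_tmul_truncY {n : ℕ} {a b : ℕ → A}
    (h : ∑ j ∈ Finset.range n, a j ⊗ₜ[k] (truncY k n ^ j) =
      ∑ j ∈ Finset.range n, b j ⊗ₜ[k] (truncY k n ^ j)) : ∀ j < n, a j = b j := by
  intro j hj
  have key : ∀ c : ℕ → A, TensorProduct.rid k A (LinearMap.lTensor A (truncCoeff k n j)
      (∑ i ∈ Finset.range n, c i ⊗ₜ[k] (truncY k n ^ i))) = c j := by
    intro c
    rw [map_sum, map_sum, Finset.sum_eq_single j]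
    · simp [truncCoeff_pow k hj]
    · intro i _ hi
      simp [truncCoeff_pow k hj, hi.symm]
    · intro h1
      exact absurd (Finset.mem_range.2 hj) h1
  rw [← key a, ← key b, h]

theorem twist_hom_ext {V : Type*} [AddCommGroup V] [Module k V] {n : ℕ}
    {s t : TruncPoly k n ⊗[k] A →ₗ[k] V}
    (h : ∀ r a, s ((truncY k n ^ r) ⊗ₜ[k] a) = t ((truncY k n ^ r) ⊗ₜ[k] a)) : s = t := by
  refine TensorProduct.ext' fun c a => ?_
  induction c using truncPoly_induction with
  | hadd c d hc hd => rw [TensorProduct.add_tmul, map_add, map_add, hc, hd]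
  | hpow u r => rw [← TensorProduct.smul_tmul', map_smul, map_smul, h]

/-- The linear map `C ⊗ A → A ⊗ C` is given by the powers of the series `M`. -/
def IsGivenBy {n : ℕ} (s : TruncPoly k n ⊗[k] A →ₗ[k] A ⊗[k] TruncPoly k n)
    (M : (Module.End k A)⟦X⟧) (r : ℕ) : Prop :=
  ∀ a, s ((truncY k n ^ r) ⊗ₜ[k] a) =
    ∑ j ∈ Finset.range n, coeff j (M ^ r) a ⊗ₜ[k] (truncY k n ^ j)

theorem IsGivenBy.mul_left {n : ℕ} {s : TruncPoly k n ⊗[k] A →ₗ[k] A ⊗[k] TruncPoly k n}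
    {M : (Module.End k A)⟦X⟧} {r t : ℕ} (hr : IsGivenBy s M r) (ht : IsGivenBy s M t) (a : A) :
    (LinearMap.lTensor A (LinearMap.mul' k (TruncPoly k n)))
      ((TensorProduct.assoc k A (TruncPoly k n) (TruncPoly k n))
        ((LinearMap.rTensor (TruncPoly k n) s)
          ((TensorProduct.assoc k (TruncPoly k n) A (TruncPoly k n)).symm
            ((truncY k n ^ r) ⊗ₜ[k] (s ((truncY k n ^ t) ⊗ₜ[k] a)))))) =
      ∑ j ∈ Finset.range n, coeff j (M ^ (r + t)) a ⊗ₜ[k] (truncY k n ^ j) := by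
  rw [ht a]
  simp only [TensorProduct.tmul_sum, map_sum, TensorProduct.assoc_symm_tmul,
    LinearMap.rTensor_tmul]
  simp only [hr _, TensorProduct.sum_tmul, map_sum, TensorProduct.assoc_tmul,
    LinearMap.lTensor_tmul, LinearMap.mul'_apply, ← pow_add]
  rw [Finset.sum_comm, sum_range_sum_range_eq_sum_antidiagonal]
  · refine Finset.sum_congr rfl fun q _ => ?_
    rw [pow_add M, coeff_mul, LinearMap.sum_apply, TensorProduct.sum_tmul]
    refine Finset.sum_congr rfl fun ij hij => ?_
    rw [mem_antidiagonal] at hij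
    rw [hij, Module.End.mul_apply]
  · intro i j hij
    rw [truncY_pow_eq_zero k hij, TensorProduct.tmul_zero]

theorem IsGivenBy.mul_right {n : ℕ} {s : TruncPoly k n ⊗[k] A →ₗ[k] A ⊗[k] TruncPoly k n}
    {M : (Module.End k A)⟦X⟧} (hs : ∀ r, IsGivenBy s M r) (r : ℕ) (a b : A) :
    (LinearMap.rTensor (TruncPoly k n) (LinearMap.mul' k A))
      ((TensorProduct.assoc k A A (TruncPoly k n)).symm
        ((LinearMap.lTensor A s)
          ((TensorProduct.assoc k A (TruncPoly k n) A)
            ((LinearMap.rTensor A s) (((truncY k n ^ r) ⊗ₜ[k] a) ⊗ₜ[k] b))))) =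
      ∑ j ∈ Finset.range n, (∑ i ∈ Finset.range n, coeff i (M ^ r) a * coeff j (M ^ i) b) ⊗ₜ[k]
        (truncY k n ^ j) := by
  rw [LinearMap.rTensor_tmul, hs r a]
  simp only [TensorProduct.sum_tmul, map_sum, TensorProduct.assoc_tmul, LinearMap.lTensor_tmul]
  simp only [hs _ _, TensorProduct.tmul_sum, map_sum, TensorProduct.assoc_symm_tmul,
    LinearMap.rTensor_tmul, LinearMap.mul'_apply]
  rw [Finset.sum_comm]

theorem sum_coeff_one_tmul {n : ℕ} (hn : 0 < n) (a : A) :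
    ∑ j ∈ Finset.range n, coeff j (1 : (Module.End k A)⟦X⟧) a ⊗ₜ[k] (truncY k n ^ j) =
      a ⊗ₜ[k] 1 := by
  rw [Finset.sum_eq_single 0]
  · simp
  · intro j _ hj
    simp [PowerSeries.coeff_one, hj]
  · intro h0
    exact absurd (Finset.mem_range.2 hn) h0

theorem sum_ite_tmul_truncY {n : ℕ} (r : ℕ) (a : A) :
    ∑ j ∈ Finset.range n, (if j = r then a else 0) ⊗ₜ[k] (truncY k n ^ j) =
      a ⊗ₜ[k] (truncY k n ^ r) := by
  rcases lt_or_ge r n with hr | hr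
  · rw [Finset.sum_eq_single r]
    · simp
    · intro j _ hj
      simp [hj]
    · intro h0
      exact absurd (Finset.mem_range.2 hr) h0
  · rw [truncY_pow_eq_zero k hr, TensorProduct.tmul_zero]
    refine Finset.sum_eq_zero fun j hj => ?_
    rw [if_neg (by rw [Finset.mem_range] at hj; omega), TensorProduct.zero_tmul]

theorem isGivenBy_of_isTwistingMap {n : ℕ} (hn : 0 < n)
    {s : TruncPoly k n ⊗[k] A →ₗ[k] A ⊗[k] TruncPoly k n}
    (hs : IsTwistingMap k A (TruncPoly k n) s) {M : (Module.End k A)⟦X⟧}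
    (hM : IsGivenBy s M 1) (r : ℕ) : IsGivenBy s M r := by
  induction r with
  | zero =>
    intro a
    rw [pow_zero, pow_zero, hs.1, sum_coeff_one_tmul hn]
  | succ r ih =>
    intro a
    rw [add_comm, pow_add, hs.2.2.1, hM.mul_left ih]

theorem isTwistSeries_of_isTwistingMap {n : ℕ} (hn : 0 < n)
    {s : TruncPoly k n ⊗[k] A →ₗ[k] A ⊗[k] TruncPoly k n}
    (hs : IsTwistingMap k A (TruncPoly k n) s) {M : (Module.End k A)⟦X⟧}
    (hM : IsGivenBy s M 1) : IsTwistSeries n M := by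
  have hall := isGivenBy_of_isTwistingMap hn hs hM
  refine ⟨?_, ?_, ?_⟩
  · refine eq_of_sum_tmul_truncY (k := k) ?_
    rw [sum_ite_tmul_truncY, ← hs.2.1, hM, pow_one]
  · intro q hq
    ext a
    refine eq_of_sum_tmul_truncY (k := k) (a := fun q => coeff q (M ^ n) a) (b := 0) ?_ q hq
    rw [← hall n a, truncY_pow_eq_zero k le_rfl]
    simp
  · intro a q hq
    ext b
    rw [coeff_mul_leftMul, coeff_sum_leftMul_mul]
    refine eq_of_sum_tmul_truncY (k := k) (a := fun q => coeff q M (a * b))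
      (b := fun q => ∑ j ∈ Finset.range n, coeff j M a * coeff q (M ^ j) b) ?_ q hq
    have h1 := hM (a * b)
    have h2 := IsGivenBy.mul_right hall 1 a b
    rw [pow_one M] at h1 h2
    rw [← h1, hs.2.2.2, h2]

/-- The linear map `C ⊗ A → A ⊗ C` given by the powers of the series `M`. -/
def twistOfSeries (n : ℕ) (M : (Module.End k A)⟦X⟧) :
    TruncPoly k n ⊗[k] A →ₗ[k] A ⊗[k] TruncPoly k n :=
  TensorProduct.lift (∑ r ∈ Finset.range n, (truncCoeff k n r).smulRight
    (∑ j ∈ Finset.range n,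
      (TensorProduct.mk k A (TruncPoly k n)).flip (truncY k n ^ j) ∘ₗ coeff j (M ^ r)))

theorem IsTwistSeries.isGivenBy {n : ℕ} {M : (Module.End k A)⟦X⟧} (hT : IsTwistSeries n M)
    (r : ℕ) : IsGivenBy (twistOfSeries n M) M r := by
  intro a
  rcases lt_or_ge r n with hr | hr
  · rw [twistOfSeries, TensorProduct.lift.tmul, LinearMap.sum_apply, Finset.sum_eq_single r]
    · simp [truncCoeff_pow k hr, LinearMap.sum_apply]
    · intro i hi hne
      rw [LinearMap.smulRight_apply, truncCoeff_pow k (Finset.mem_range.1 hi), if_neg hne,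
        zero_smul]
    · intro h0
      exact absurd (Finset.mem_range.2 hr) h0
  · rw [truncY_pow_eq_zero k hr, TensorProduct.zero_tmul, _root_.map_zero]
    symm
    refine Finset.sum_eq_zero fun j hj => ?_
    rw [coeff_pow_eq_zero_of_le hT.pow_eq_zero hr j (Finset.mem_range.1 hj),
      LinearMap.zero_apply, TensorProduct.zero_tmul]

/-- The twist exchanges `y^r` with `b` when the powers of `M` are right `b`-linear. -/
theorem IsTwistSeries.twist_tmul {n : ℕ} {M : (Module.End k A)⟦X⟧} (hT : IsTwistSeries n M)
    {b : A} (hb : ∀ j a, coeff j M (a * b) = coeff j M a * b) (c : TruncPoly k n) :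
    twistOfSeries n M (c ⊗ₜ[k] b) = b ⊗ₜ[k] c := by
  induction c using truncPoly_induction with
  | hadd c d hc hd => rw [TensorProduct.add_tmul, map_add, hc, hd, TensorProduct.tmul_add]
  | hpow t r =>
    rw [← TensorProduct.smul_tmul', map_smul, hT.isGivenBy, TensorProduct.tmul_smul,
      ← sum_ite_tmul_truncY]
    congr 1
    refine Finset.sum_congr rfl fun j hj => ?_
    congr 1
    have h1 := coeff_pow_mul_right hb r j 1
    rw [coeff_pow_apply_one hT.map_one r j (Finset.mem_range.1 hj), one_mul] at h1
    rw [h1]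
    split_ifs <;> simp

theorem IsTwistSeries.isTwistingMap {n : ℕ} (hn : 0 < n) {M : (Module.End k A)⟦X⟧}
    (hT : IsTwistSeries n M) : IsTwistingMap k A (TruncPoly k n) (twistOfSeries n M) := by
  have hall := hT.isGivenBy
  refine ⟨fun a => ?_, fun c => hT.twist_tmul (by simp) c, fun c c' a => ?_, fun c a b => ?_⟩
  · rw [← pow_zero (truncY k n), hall 0 a, pow_zero, pow_zero, sum_coeff_one_tmul hn]
  · induction c using truncPoly_induction with
    | hadd c d hc hd => simp only [add_mul, TensorProduct.add_tmul, map_add, hc, hd]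
    | hpow t r =>
      induction c' using truncPoly_induction with
      | hadd c d hc hd =>
        simp only [mul_add, TensorProduct.add_tmul, TensorProduct.tmul_add, map_add, hc, hd]
      | hpow u q =>
        simp only [smul_mul_assoc, mul_smul_comm, ← TensorProduct.smul_tmul',
          TensorProduct.tmul_smul, map_smul]
        rw [(hall r).mul_left (hall q), ← pow_add, hall]
  · induction c using truncPoly_induction with
    | hadd c d hc hd => simp only [TensorProduct.add_tmul, map_add, hc, hd]
    | hpow t r =>
      simp only [← TensorProduct.smul_tmul', map_smul]
      rw [IsGivenBy.mul_right hall, hall]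
      congr 1
      refine Finset.sum_congr rfl fun j hj => ?_
      rw [hT.coeff_pow_mul r a b (Finset.mem_range.1 hj)]

theorem exists_isJordanChain {g : Module.End k A} {h : ℕ} (hh : 1 < h) (hg1 : g 1 = 0)
    (hg : g ^ h = 0) {x : A} (hq : IsUnit ((g ^ (h - 1)) x))
    (hlin : ∀ a b, g b = 0 → g (a * b) = g a * b) :
    ∃ e : ℕ → A, IsJordanChain g h e := by
  obtain ⟨q, hq⟩ := hq
  have hgq : g q = 0 := by
    rw [hq, ← Module.End.mul_apply, ← pow_succ', Nat.sub_add_cancel hh.le, hg,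
      LinearMap.zero_apply]
  have hgq' : g ↑q⁻¹ = 0 := by
    have h1 := hlin (↑q⁻¹) q hgq
    rw [Units.inv_mul, hg1] at h1
    simpa using h1.symm
  refine ⟨fun m => (g ^ (h - 1 - m)) (x * ↑q⁻¹), ?_, hg1, fun m hm => ?_⟩
  · rw [Nat.sub_zero, end_pow_apply_mul (fun a => hlin a _ hgq'), ← hq, Units.mul_inv]
  · rw [← Module.End.mul_apply, ← pow_succ', show h - 1 - (m + 1) + 1 = h - 1 - m by omega]

end

end TruncatedTwist

/-- Let `h > 1` divide `n` and let `g_l : A → A` (`0 ≤ l < n/h`) be `k`-linear maps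
with `g_l(1) = 0`, `g_0^h = 0`, `q := g_0^{h-1}(x)` invertible, `B := ker g_0` a
`k`-subalgebra of the center of `A`, and each `g_l` `B`-linear. Then there is a
unique twisting map `s : k[y]/⟨y^n⟩ ⊗ A → A ⊗ k[y]/⟨y^n⟩` with `γ^1_{lh} = g_l` for
all `l`; moreover `s(c ⊗ b) = b ⊗ c` for all `c ∈ C` and `b ∈ B`. -/
theorem statement16 {k A : Type*} [CommRing k] [Ring A] [Algebra k A] (n h : ℕ)
    (hn : 0 < n) (hh : 1 < h) (hdvd : h ∣ n)
    (g : ℕ → Module.End k A)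
    (hg1 : ∀ l, l < n / h → g l 1 = 0)
    (hg0h : (g 0) ^ h = 0)
    (x : A) (hq : IsUnit (((g 0) ^ (h - 1)) x))
    (hBmul : ∀ b b' : A, g 0 b = 0 → g 0 b' = 0 → g 0 (b * b') = 0)
    (hBcentral : ∀ b : A, g 0 b = 0 → ∀ a : A, a * b = b * a)
    (hglin : ∀ l, l < n / h → ∀ a b : A, g 0 b = 0 → g l (a * b) = g l a * b) :
    ∃! s : TruncPoly k n ⊗[k] A →ₗ[k] A ⊗[k] TruncPoly k n,
      IsTwistingMap k A (TruncPoly k n) s ∧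
      (∃ γ : ℕ → ℕ → Module.End k A,
        (∀ r < n, ∀ a : A,
          s (((truncY k n) ^ r) ⊗ₜ[k] a) =
            ∑ j ∈ Finset.range n, γ r j a ⊗ₜ[k] ((truncY k n) ^ j)) ∧
        (∀ l, l < n / h → γ 1 (l * h) = g l)) ∧
      (∀ b : A, g 0 b = 0 → ∀ c : TruncPoly k n,
        s (c ⊗ₜ[k] b) = b ⊗ₜ[k] c) := by
  obtain ⟨m, rfl⟩ := hdvd
  have hm : 0 < m := Nat.pos_of_mul_pos_left hn
  rw [Nat.mul_div_cancel_left m (by omega)] at *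
  rw [mul_comm h m] at *
  have hlin0 := hglin 0 hm
  obtain ⟨e, H⟩ := TruncatedTwist.exists_isJordanChain hh (hg1 0 hm) hg0h hq hlin0
  obtain ⟨M, hT, hMlin, hM⟩ :=
    TruncatedTwist.IsTwistSeries.exists_of_dvd hh H hg0h hBcentral hg1 hglin
  have hM0 : PowerSeries.coeff 0 M = g 0 := by simpa using hM 0 hm
  refine ⟨TruncatedTwist.twistOfSeries (m * h) M, ⟨hT.isTwistingMap hn,
    ⟨fun r j => PowerSeries.coeff j (M ^ r), fun r _ a => hT.isGivenBy r a, fun l hl => ?_⟩,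
    fun b hb c => hT.twist_tmul (hMlin b hb) c⟩, ?_⟩
  · simpa using hM l hl
  · rintro s ⟨hs, ⟨γ, hγ, hγg⟩, -⟩
    have h1 : 1 < m * h := lt_of_lt_of_le hh (Nat.le_mul_of_pos_left h hm)
    have hN : TruncatedTwist.IsGivenBy s (PowerSeries.mk (γ 1)) 1 := by
      intro a
      rw [hγ 1 h1]
      simp
    have hT' := TruncatedTwist.isTwistSeries_of_isTwistingMap hn hs hN
    have heq := hT.coeff_eq hh hT' (hM0.symm ▸ H) (hM0.symm ▸ hg0h) fun l hl => by
      rw [hM l hl, PowerSeries.coeff_mk, hγg l hl]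
    have hN' : TruncatedTwist.IsGivenBy s M 1 := by
      intro a
      rw [hN a]
      refine Finset.sum_congr rfl fun j hj => ?_
      rw [pow_one, pow_one, heq j (Finset.mem_range.1 hj)]
    refine TruncatedTwist.twist_hom_ext fun r a => ?_
    rw [hT.isGivenBy r a, TruncatedTwist.isGivenBy_of_isTwistingMap hn hs hN' r a]
end

section
/- Let A := k[x]/⟨x^m⟩ and let P_1, …, P_{n-1} ∈ A be polynomials each divisible by x. Then there exists a unique upper triangular twisting map s_n : C_n⊗A → A⊗C_n (C_n = k[y]/⟨y^n⟩, γ^1_0 = 0) with γ^1_j(x) = P_j for j = 1, …, n−1. -/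
open TensorProduct

/-- Let `Γ` act on `B` and on `M`, raising a finite filtration of `M`, and satisfy
`Γ X = ∑ r ∈ I, P r Γ ^ r` on both. A linear map commuting with `t`, `X` and the `P r` commutes
with `Γ` as soon as it does so on a generator of `B`. -/
theorem map_comm_of_relation {k B M : Type*} [CommRing k] [AddCommGroup B] [Module k B]
    [AddCommGroup M] [Module k M] (θ : B →ₗ[k] M) (I : Finset ℕ) (hI : ∀ r ∈ I, 1 ≤ r)
    (tB XB ΓB : Module.End k B) (PB : ℕ → Module.End k B)
    (tM XM ΓM : Module.End k M) (PM : ℕ → Module.End k M)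
    (F : ℕ → Submodule k M) (n : ℕ) (hF0 : F 0 = ⊤) (hFn : F n = ⊥)
    (hF : ∀ N, F (N + 1) ≤ F N)
    (hFt : ∀ N, ∀ v ∈ F N, tM v ∈ F (N + 1)) (hFΓ : ∀ N, ∀ v ∈ F N, ΓM v ∈ F (N + 1))
    (hFP : ∀ r N, ∀ v ∈ F N, PM r v ∈ F N)
    (ht : ∀ w, θ (tB w) = tM (θ w)) (hX : ∀ w, θ (XB w) = XM (θ w))
    (hP : ∀ r w, θ (PB r w) = PM r (θ w))
    (hΓB : ∀ w, ∃ v, ΓB w = tB v)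
    (hcB : ∀ w, ΓB (tB w) = tB (ΓB w)) (hcM : ∀ w, ΓM (tM w) = tM (ΓM w))
    (heB : ∀ w, ΓB (XB w) = ∑ r ∈ I, PB r ((ΓB ^ r) w))
    (heM : ∀ w, ΓM (XM w) = ∑ r ∈ I, PM r ((ΓM ^ r) w))
    (b : B) (hb : θ (ΓB b) = ΓM (θ b))
    (hspan : ∀ S : Submodule k B, b ∈ S → (∀ w ∈ S, XB w ∈ S) → (∀ w, tB w ∈ S) → S = ⊤)
    (w : B) : θ (ΓB w) = ΓM (θ w) := by
  have key : ∀ N, ∀ w, θ (ΓB w) - ΓM (θ w) ∈ F N := by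
    intro N
    induction N with
    | zero => simp [hF0]
    | succ N ih =>
      have hmono : ∀ w, θ (ΓB (tB w)) - ΓM (θ (tB w)) ∈ F (N + 1) := by
        intro w
        have := hFt N _ (ih w)
        rwa [map_sub, ← ht, ← hcM, ← hcB, ← ht] at this
      have step : ∀ r w, θ ((ΓB ^ (r + 1)) w) - (ΓM ^ (r + 1)) (θ w) ∈ F N →
          θ ((ΓB ^ (r + 2)) w) - (ΓM ^ (r + 2)) (θ w) ∈ F (N + 1) := by
        intro r w h
        obtain ⟨v, hv⟩ := hΓB ((ΓB ^ r) w)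
        have e : θ ((ΓB ^ (r + 2)) w) - (ΓM ^ (r + 2)) (θ w) =
            (θ (ΓB (tB v)) - ΓM (θ (tB v))) +
              ΓM (θ ((ΓB ^ (r + 1)) w) - (ΓM ^ (r + 1)) (θ w)) := by
          rw [map_sub, ← hv, pow_succ' ΓB (r + 1), pow_succ' ΓM (r + 1),
            Module.End.mul_apply, Module.End.mul_apply, pow_succ' ΓB r, Module.End.mul_apply]
          abel
        rw [e]
        exact add_mem (hmono v) (hFΓ N _ h)
      have base : ∀ r w, θ ((ΓB ^ (r + 1)) w) - (ΓM ^ (r + 1)) (θ w) ∈ F N := by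
        intro r w
        induction r with
        | zero => simpa using ih w
        | succ r ihr => exact hF N (step r w ihr)
      let S : Submodule k B := (F (N + 1)).comap (θ ∘ₗ ΓB - ΓM ∘ₗ θ)
      have hS : ∀ w, w ∈ S ↔ θ (ΓB w) - ΓM (θ w) ∈ F (N + 1) := fun w => Iff.rfl
      have hST : S = ⊤ := by
        refine hspan S ?_ ?_ ?_
        · rw [hS, hb, sub_self]
          exact zero_mem _
        · intro w hw
          rw [hS] at hw ⊢
          rw [heB, hX, heM, map_sum, ← Finset.sum_sub_distrib]
          refine sum_mem fun r hr => ?_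
          rw [hP, ← map_sub]
          refine hFP r _ _ ?_
          obtain ⟨r, rfl⟩ := Nat.exists_eq_add_of_le' (hI r hr)
          cases r with
          | zero => simpa using hw
          | succ r => exact step r w (base r w)
        · exact fun w => (hS _).2 (hmono w)
      intro w
      rw [← hS, hST]
      exact Submodule.mem_top
  have := key n w
  rwa [hFn, Submodule.mem_bot, sub_eq_zero] at this

/-- A fixed-point equation that is contracting for the filtration by powers of a central nilpotent
element has a solution. -/
theorem exists_fixed_point {E : Type*} [Ring E] (t : E) (ht : ∀ z, t * z = z * t) (n : ℕ)
    (htn : t ^ n = 0) (S : E →+ E) (hS : ∀ z, S (t * z) = t * S z) (I : Finset ℕ)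
    (hI : ∀ r ∈ I, 2 ≤ r) (Q : ℕ → E) (G : E) (hG : t ∣ G) :
    ∃ Γ, t ∣ Γ ∧ Γ = G + S (∑ r ∈ I, Q r * Γ ^ r) := by
  have hSd : ∀ N z, t ^ N ∣ z → t ^ N ∣ S z := by
    intro N
    induction N with
    | zero => simp
    | succ N ih =>
      rintro _ ⟨z, rfl⟩
      rw [pow_succ', mul_assoc, hS]
      exact mul_dvd_mul_left t (ih _ ⟨z, rfl⟩)
  have htc : ∀ N z, t ^ N * z = z * t ^ N := fun N z => (Commute.pow_left (ht z) N).eq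
  have hdl : ∀ N a z, t ^ N ∣ z → t ^ N ∣ a * z := by
    rintro N a _ ⟨z, rfl⟩
    exact ⟨a * z, by rw [← mul_assoc, ← htc, mul_assoc]⟩
  have hdm : ∀ N a z, t ∣ a → t ^ N ∣ z → t ^ (N + 1) ∣ a * z := by
    rintro N _ _ ⟨a, rfl⟩ h
    rw [pow_succ', mul_assoc]
    exact mul_dvd_mul_left t (hdl N a _ h)
  have hdm' : ∀ N a z, t ∣ a → t ^ N ∣ z → t ^ (N + 1) ∣ z * a := by
    rintro N _ _ ⟨a, rfl⟩ ⟨z, rfl⟩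
    exact ⟨z * a, by rw [pow_succ, mul_assoc, mul_assoc, ← mul_assoc z, ← ht z, mul_assoc]⟩
  let T : E → E := fun Γ => G + S (∑ r ∈ I, Q r * Γ ^ r)
  have hT : ∀ Γ, t ∣ Γ → t ∣ T Γ := by
    intro Γ hΓ
    refine dvd_add hG ?_
    have := hSd 1 (∑ r ∈ I, Q r * Γ ^ r) (Finset.dvd_sum fun r hr => hdl 1 _ _ ?_)
    · simpa using this
    · rw [pow_one]
      exact hΓ.trans (dvd_pow_self Γ (by have := hI r hr; omega))
  have hpow : ∀ N Γ Γ', t ∣ Γ → t ∣ Γ' → t ^ N ∣ Γ - Γ' →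
      ∀ r, t ^ (N + 1) ∣ Γ ^ (r + 2) - Γ' ^ (r + 2) := by
    intro N Γ Γ' h h' hd r
    have e : ∀ r, Γ ^ (r + 1) - Γ' ^ (r + 1) = Γ * (Γ ^ r - Γ' ^ r) + (Γ - Γ') * Γ' ^ r := by
      intro r
      rw [pow_succ', pow_succ']
      noncomm_ring
    induction r with
    | zero =>
      rw [e 1, pow_one, pow_one]
      exact dvd_add (hdm N _ _ h hd) (hdm' N _ _ h' hd)
    | succ r ih =>
      rw [e (r + 2)]
      exact dvd_add (hdl _ _ _ ih)
        (hdm' N _ _ (h'.trans (dvd_pow_self _ (by omega))) hd)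
  have hcontr : ∀ N Γ Γ', t ∣ Γ → t ∣ Γ' → t ^ N ∣ Γ - Γ' → t ^ (N + 1) ∣ T Γ - T Γ' := by
    intro N Γ Γ' h h' hd
    have e : T Γ - T Γ' = S (∑ r ∈ I, Q r * (Γ ^ r - Γ' ^ r)) := by
      simp only [T, mul_sub, Finset.sum_sub_distrib, map_sub]
      abel
    rw [e]
    refine hSd _ _ (Finset.dvd_sum fun r hr => hdl _ _ _ ?_)
    obtain ⟨r, rfl⟩ := Nat.exists_eq_add_of_le' (hI r hr)
    exact hpow N Γ Γ' h h' hd r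
  have hit : ∀ N, t ∣ T^[N] 0 := by
    intro N
    induction N with
    | zero => simp
    | succ N ih =>
      rw [Function.iterate_succ_apply']
      exact hT _ ih
  have hconv : ∀ N, t ^ N ∣ T^[N] 0 - T (T^[N] 0) := by
    intro N
    induction N with
    | zero => simp
    | succ N ih =>
      rw [Function.iterate_succ_apply']
      exact hcontr N _ _ (hit N) (hT _ (hit N)) ih
  refine ⟨T^[n] 0, hit n, ?_⟩
  have := hconv n
  rwa [htn, zero_dvd_iff, sub_eq_zero] at this

/-- The endomorphisms preserving the multiples of every power of `x`. -/
def filteredEnd (k : Type*) {A : Type*} [CommRing k] [CommRing A] [Algebra k A] (x : A) :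
    Subalgebra k (Module.End k A) where
  carrier := {f | ∀ i a, x ^ i ∣ a → x ^ i ∣ f a}
  mul_mem' hf hg i a h := hf i _ (hg i a h)
  add_mem' hf hg i a h := dvd_add (hf i a h) (hg i a h)
  algebraMap_mem' c i a h := by
    rw [Module.algebraMap_end_apply]
    exact dvd_smul_of_dvd c h

/-- Multiplication as a map into the filtered endomorphisms. -/
def mulFiltered (k : Type*) {A : Type*} [CommRing k] [CommRing A] [Algebra k A] (x : A) :
    A →ₐ[k] filteredEnd k x :=
  (Algebra.lmul k A).codRestrict (filteredEnd k x) fun a _ _ h => dvd_mul_of_dvd_right h a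

@[simp]
theorem mulFiltered_apply {k A : Type*} [CommRing k] [CommRing A] [Algebra k A] (x a b : A) :
    (mulFiltered k x a : Module.End k A) b = a * b := rfl

theorem truncPoly_induction (k : Type*) [CommRing k] (n : ℕ) (S : Submodule k (TruncPoly k n))
    (h1 : 1 ∈ S) (hX : ∀ a ∈ S, truncY k n * a ∈ S) : S = ⊤ := by
  have hpow : ∀ i, truncY k n ^ i ∈ S := by
    intro i
    induction i with
    | zero => simpa using h1
    | succ i ih =>
      rw [pow_succ']
      exact hX _ ih
  rw [eq_top_iff]
  rintro a -
  obtain ⟨p, rfl⟩ := Ideal.Quotient.mk_surjective a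
  induction p using Polynomial.induction_on' with
  | add p q hp hq =>
    rw [map_add]
    exact add_mem hp hq
  | monomial i c =>
    have : Ideal.Quotient.mk (Ideal.span {(Polynomial.X : Polynomial k) ^ n})
        (Polynomial.monomial i c) = c • truncY k n ^ i := by
      rw [← Polynomial.smul_X_eq_monomial, truncY, ← map_pow]
      rfl
    rw [this]
    exact S.smul_mem c (hpow i)

theorem truncY_pow (k : Type*) [CommRing k] (n : ℕ) : truncY k n ^ n = 0 := by
  rw [truncY, ← map_pow, Ideal.Quotient.eq_zero_iff_mem]
  exact Ideal.mem_span_singleton_self _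

theorem exists_algHom_truncPoly {k E : Type*} [CommRing k] [Ring E] [Algebra k E] (n : ℕ) (Γ : E)
    (h : Γ ^ n = 0) : ∃ ψ : TruncPoly k n →ₐ[k] E, ψ (truncY k n) = Γ := by
  refine ⟨Ideal.Quotient.liftₐ _ (Polynomial.aeval Γ) fun a ha => ?_, ?_⟩
  · obtain ⟨q, rfl⟩ := Ideal.mem_span_singleton.1 ha
    rw [map_mul, map_pow, Polynomial.aeval_X, h, zero_mul]
  · exact Polynomial.aeval_X Γ

theorem exists_linearMap_truncPoly {k M : Type*} [CommRing k] [AddCommGroup M] [Module k M] (n : ℕ)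
    (f : Polynomial k →ₗ[k] M) (hf : ∀ p, f (Polynomial.X ^ n * p) = 0) :
    ∃ g : TruncPoly k n →ₗ[k] M, ∀ p, g (Ideal.Quotient.mkₐ k _ p) = f p := by
  let q : Polynomial k →ₐ[k] TruncPoly k n := Ideal.Quotient.mkₐ k _
  have hq : Function.Surjective q := Ideal.Quotient.mkₐ_surjective k _
  have hfq : ∀ p r, q p = q r → f p = f r := by
    intro p r h
    obtain ⟨u, hu⟩ := Ideal.mem_span_singleton.1 (Ideal.Quotient.eq.1 h)
    rw [← sub_eq_zero, ← map_sub, hu, hf]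
  have hs : ∀ a, q (Function.surjInv hq a) = a := Function.surjInv_eq hq
  refine ⟨⟨⟨fun a => f (Function.surjInv hq a), fun a b => ?_⟩, fun c a => ?_⟩, fun p => ?_⟩
  · rw [← map_add]
    exact hfq _ _ (by rw [map_add, hs, hs, hs])
  · rw [← map_smul]
    exact hfq _ _ (by rw [map_smul, hs, hs]; rfl)
  · exact hfq _ _ (hs _)

/-- Coefficient functionals on the truncated polynomials. -/
theorem exists_truncPoly_coeff (k : Type*) [CommRing k] (n : ℕ) :
    ∃ π : ℕ → TruncPoly k n →ₗ[k] k,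
      (∀ j < n, ∀ i, π j (truncY k n ^ i) = if i = j then 1 else 0) ∧
      ∀ c, ∑ j ∈ Finset.range n, π j c • truncY k n ^ j = c := by
  classical
  have hex : ∀ j, ∃ π : TruncPoly k n →ₗ[k] k, j < n → ∀ i,
      π (truncY k n ^ i) = if i = j then 1 else 0 := by
    intro j
    by_cases hj : j < n
    · obtain ⟨π, hπ⟩ := exists_linearMap_truncPoly n (Polynomial.lcoeff k j) fun p => by
        rw [Polynomial.lcoeff_apply, Polynomial.coeff_X_pow_mul', if_neg (by omega)]
      refine ⟨π, fun _ i => ?_⟩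
      have : truncY k n ^ i = Ideal.Quotient.mkₐ k _ (Polynomial.X ^ i) := (map_pow _ _ _).symm
      rw [this, hπ, Polynomial.lcoeff_apply, Polynomial.coeff_X_pow]
      exact if_congr eq_comm rfl rfl
    · exact ⟨0, fun h => absurd h hj⟩
  choose π hπ using hex
  refine ⟨π, hπ, fun c => ?_⟩
  let S : Submodule k (TruncPoly k n) :=
    LinearMap.eqLocus (∑ j ∈ Finset.range n, (π j).smulRight (truncY k n ^ j)) LinearMap.id
  have hS : ∀ c, c ∈ S ↔ ∑ j ∈ Finset.range n, π j c • truncY k n ^ j = c := by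
    intro c
    simp [S, LinearMap.mem_eqLocus]
  have hpow : ∀ i, truncY k n ^ i ∈ S := by
    intro i
    rw [hS]
    have : ∀ j ∈ Finset.range n, π j (truncY k n ^ i) • truncY k n ^ j =
        if i = j then truncY k n ^ i else 0 := by
      intro j hj
      rw [hπ j (Finset.mem_range.1 hj)]
      split_ifs with h <;> simp [h]
    rw [Finset.sum_congr rfl this, Finset.sum_ite_eq]
    split_ifs with h
    · rfl
    · rw [Finset.mem_range, not_lt] at h
      rw [pow_eq_zero_of_le h (truncY_pow k n)]
  rw [← hS]
  have : Submodule.span k (Set.range fun i => truncY k n ^ i) = ⊤ := by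
    refine truncPoly_induction k n _ (Submodule.subset_span ⟨0, by simp⟩) fun a ha => ?_
    induction ha using Submodule.span_induction with
    | mem a h =>
      obtain ⟨i, rfl⟩ := h
      exact Submodule.subset_span ⟨i + 1, by simp [pow_succ']⟩
    | zero => simp
    | add a b _ _ ha hb =>
      rw [mul_add]
      exact add_mem ha hb
    | smul r a _ ha =>
      rw [mul_smul_comm]
      exact Submodule.smul_mem _ r ha
  have hle : Submodule.span k (Set.range fun i => truncY k n ^ i) ≤ S :=
    Submodule.span_le.2 (by rintro _ ⟨i, rfl⟩; exact hpow i)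
  exact hle (this ▸ Submodule.mem_top)

/-- Solving `f (x b) = x (Q (f b) + h b)` with prescribed `f 1`. -/
theorem exists_filteredEnd (k : Type*) [CommRing k] (m : ℕ) (Q c : TruncPoly k m)
    (h : filteredEnd k (truncY k m)) : ∃ f : filteredEnd k (truncY k m),
      (f : Module.End k (TruncPoly k m)) 1 = c ∧ ∀ b, (f : Module.End k (TruncPoly k m))
        (truncY k m * b) = truncY k m * (Q * (f : Module.End k (TruncPoly k m)) b +
          (h : Module.End k (TruncPoly k m)) b) := by
  let q : Polynomial k →ₐ[k] TruncPoly k m := Ideal.Quotient.mkₐ k _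
  have hq : Function.Surjective q := Ideal.Quotient.mkₐ_surjective k _
  have hqX : q Polynomial.X = truncY k m := rfl
  let F : ℕ → TruncPoly k m := fun i =>
    Nat.rec c (fun i v => truncY k m * (Q * v + h.1 (truncY k m ^ i))) i
  have hF : ∀ i, F (i + 1) = truncY k m * (Q * F i + h.1 (truncY k m ^ i)) := fun i => rfl
  let f : Polynomial k →ₗ[k] TruncPoly k m := (Polynomial.basisMonomials k).constr k F
  have hf : ∀ i, f (Polynomial.X ^ i) = F i := by
    intro i
    have := (Polynomial.basisMonomials k).constr_basis k F i
    rw [Polynomial.coe_basisMonomials] at this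
    exact (congrArg f (Polynomial.monomial_one_right_eq_X_pow i)).symm.trans this
  have hrec : ∀ p, f (Polynomial.X * p) = truncY k m * (Q * f p + h.1 (q p)) := by
    intro p
    induction p using Polynomial.induction_on' with
    | add p r hp hr =>
      rw [mul_add, map_add, hp, hr, map_add, map_add, map_add]
      ring
    | monomial i a =>
      rw [← Polynomial.smul_X_eq_monomial, mul_smul_comm, ← pow_succ', map_smul, hf, hF, map_smul,
        hf, map_smul, map_pow q, hqX, map_smul, mul_smul_comm, ← smul_add, mul_smul_comm]
  have hdvd : ∀ i p, truncY k m ^ i ∣ f (Polynomial.X ^ i * p) := by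
    intro i
    induction i with
    | zero => simp
    | succ i ih =>
      intro p
      rw [pow_succ' Polynomial.X, mul_assoc, hrec, pow_succ']
      refine mul_dvd_mul_left (truncY k m) (dvd_add (dvd_mul_of_dvd_right (ih p) Q) (h.2 i _ ?_))
      rw [map_mul, map_pow, hqX]
      exact dvd_mul_right _ _
  obtain ⟨g, hg⟩ : ∃ g : Module.End k (TruncPoly k m), ∀ p, g (q p) = f p :=
    exists_linearMap_truncPoly m f fun p => by
      have := hdvd m p
      rwa [truncY_pow, zero_dvd_iff] at this
  refine ⟨⟨g, ?_⟩, ?_, ?_⟩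
  · rintro i _ ⟨b, rfl⟩
    obtain ⟨p, rfl⟩ := hq b
    rw [← hqX, ← map_pow, ← map_mul, hg, map_pow, hqX]
    exact hdvd i p
  · change g 1 = c
    rw [← map_one q, hg, ← pow_zero Polynomial.X, hf]
    rfl
  · intro b
    obtain ⟨p, rfl⟩ := hq b
    have e : g (truncY k m * q p) = f (Polynomial.X * p) := by
      rw [← hg, map_mul q, hqX]
    change g (truncY k m * q p) = truncY k m * (Q * g (q p) + h.1 (q p))
    rw [e, hg, hrec]

/-- A linear choice of solutions of `f (x b) = x (Q (f b) + h b)` with `f 1 = 0`. -/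
theorem exists_linear_filteredEnd (k : Type*) [CommRing k] (m : ℕ) (Q : TruncPoly k m) :
    ∃ S : filteredEnd k (truncY k m) →ₗ[k] filteredEnd k (truncY k m),
      (∀ h, (S h : Module.End k (TruncPoly k m)) 1 = 0) ∧
      ∀ h, S h * mulFiltered k _ (truncY k m) =
        mulFiltered k _ (truncY k m) * (mulFiltered k _ Q * S h + h) := by
  choose S hS1 hSx using exists_filteredEnd k m Q 0
  have uniq : ∀ f g : Module.End k (TruncPoly k m), f 1 = g 1 →
      (∀ b, f (truncY k m * b) - g (truncY k m * b) = truncY k m * (Q * (f b - g b))) →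
      f = g := by
    intro f g h1 hx
    have := truncPoly_induction k m (LinearMap.eqLocus f g) h1 fun a ha => by
      rw [LinearMap.mem_eqLocus] at ha ⊢
      rw [← sub_eq_zero, hx, ha, sub_self, mul_zero, mul_zero]
    exact LinearMap.eqLocus_eq_top.1 this
  refine ⟨⟨⟨S, fun a b => Subtype.ext (uniq _ _ ?_ fun w => ?_)⟩,
    fun r a => Subtype.ext (uniq _ _ ?_ fun w => ?_)⟩, hS1, fun h => ?_⟩
  · simp [hS1]
  · simp only [Subalgebra.coe_add, LinearMap.add_apply, hSx]
    ring
  · simp [hS1]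
  · change (S (r • a)).1 (truncY k m * w) - r • (S a).1 (truncY k m * w) =
      truncY k m * (Q * ((S (r • a)).1 w - r • (S a).1 w))
    rw [hSx, hSx]
    change truncY k m * (_ + r • a.1 w) - _ = _
    simp only [smul_add, mul_add, mul_sub, mul_smul_comm]
    ring
  · refine Subtype.ext (LinearMap.ext fun b => ?_)
    simpa using hSx h b

section

variable {k A C D : Type*} [CommRing k] [CommRing A] [CommRing C] [Algebra k A] [Algebra k C]
  [Ring D] [Algebra k D]

/-- The action of `D ⊗ C` on `A ⊗ C` induced by an action of `D` on `A`. -/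
noncomputable def tensorAction (C : Type*) [CommRing C] [Algebra k C]
    (act : D →ₐ[k] Module.End k A) : D ⊗[k] C →ₐ[k] Module.End k (A ⊗[k] C) :=
  (Module.endTensorEndAlgHom (R := k) (S := k) (A := k) (M := A) (N := C)).comp
    (Algebra.TensorProduct.map act (Algebra.lmul k C))

@[simp]
theorem tensorAction_tmul (act : D →ₐ[k] Module.End k A) (d : D) (c c' : C) (a : A) :
    tensorAction C act (d ⊗ₜ c) (a ⊗ₜ c') = act d a ⊗ₜ (c * c') := rfl

theorem one_tmul_mul_comm (c : C) (z : D ⊗[k] C) :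
    (1 ⊗ₜ c) * z = z * (1 ⊗ₜ c) := by
  induction z with
  | zero => simp
  | add u v hu hv => rw [mul_add, add_mul, hu, hv]
  | tmul d c' => simp [mul_comm]

/-- The left `C`-action on `A ⊗ C` extending `s`. -/
noncomputable def twistAction (s : C ⊗[k] A →ₗ[k] A ⊗[k] C) (c : C) : Module.End k (A ⊗[k] C) :=
  LinearMap.lTensor A (LinearMap.mul' k C) ∘ₗ (TensorProduct.assoc k A C C).toLinearMap ∘ₗ
    LinearMap.rTensor C s ∘ₗ (TensorProduct.assoc k C A C).symm.toLinearMap ∘ₗ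
      TensorProduct.mk k C (A ⊗[k] C) c

/-- The right `A`-action on `A ⊗ C` extending `s`. -/
noncomputable def twistActionRight (s : C ⊗[k] A →ₗ[k] A ⊗[k] C) (a : A) :
    Module.End k (A ⊗[k] C) :=
  LinearMap.rTensor C (LinearMap.mul' k A) ∘ₗ (TensorProduct.assoc k A A C).symm.toLinearMap ∘ₗ
    LinearMap.lTensor A s ∘ₗ (TensorProduct.assoc k A C A).toLinearMap ∘ₗ
      (TensorProduct.mk k (A ⊗[k] C) A).flip a

theorem twistAction_tmul (s : C ⊗[k] A →ₗ[k] A ⊗[k] C) (c c' : C) (a : A) :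
    twistAction s c (a ⊗ₜ c') = (1 ⊗ₜ c') * s (c ⊗ₜ a) := by
  have : ∀ w : A ⊗[k] C, LinearMap.lTensor A (LinearMap.mul' k C)
      (TensorProduct.assoc k A C C (w ⊗ₜ c')) = (1 ⊗ₜ c') * w := by
    intro w
    induction w with
    | zero => simp
    | add u v hu hv => rw [add_tmul, map_add, map_add, hu, hv, mul_add]
    | tmul e d => simp [mul_comm]
  exact this _

theorem twistActionRight_tmul (s : C ⊗[k] A →ₗ[k] A ⊗[k] C) (c : C) (a a' : A) :
    twistActionRight s a' (a ⊗ₜ c) = (a ⊗ₜ 1) * s (c ⊗ₜ a') := by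
  have : ∀ w : A ⊗[k] C, LinearMap.rTensor C (LinearMap.mul' k A)
      ((TensorProduct.assoc k A A C).symm (a ⊗ₜ w)) = (a ⊗ₜ 1) * w := by
    intro w
    induction w with
    | zero => simp
    | add u v hu hv => rw [tmul_add, map_add, map_add, hu, hv, mul_add]
    | tmul e d => simp
  exact this _

theorem isTwistingMap_iff (s : C ⊗[k] A →ₗ[k] A ⊗[k] C) :
    IsTwistingMap k A C s ↔ (∀ a : A, s (1 ⊗ₜ a) = a ⊗ₜ 1) ∧ (∀ c : C, s (c ⊗ₜ 1) = 1 ⊗ₜ c) ∧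
      (∀ c c' a, s ((c * c') ⊗ₜ a) = twistAction s c (s (c' ⊗ₜ a))) ∧
      ∀ c a a', s (c ⊗ₜ (a * a')) = twistActionRight s a' (s (c ⊗ₜ a)) := Iff.rfl

theorem twistAction_mul_right (s : C ⊗[k] A →ₗ[k] A ⊗[k] C) (c c' : C) (w : A ⊗[k] C) :
    twistAction s c ((1 ⊗ₜ c') * w) = (1 ⊗ₜ c') * twistAction s c w := by
  induction w with
  | zero => simp
  | add u v hu hv => rw [mul_add, map_add, map_add, hu, hv, mul_add]
  | tmul e d =>
    rw [Algebra.TensorProduct.tmul_mul_tmul, one_mul, twistAction_tmul, twistAction_tmul,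
      ← mul_assoc, Algebra.TensorProduct.tmul_mul_tmul, one_mul]

theorem tensorAction_mul_right (act : D →ₐ[k] Module.End k A) (z : D ⊗[k] C) (c : C)
    (w : A ⊗[k] C) : tensorAction C act z ((1 ⊗ₜ c) * w) = (1 ⊗ₜ c) * tensorAction C act z w := by
  have h : ∀ w, tensorAction C act (1 ⊗ₜ c) w = (1 ⊗ₜ c) * w := by
    intro w
    induction w with
    | zero => simp
    | add u v hu hv => rw [map_add, hu, hv, mul_add]
    | tmul e d => simp
  rw [← h, ← h, ← Module.End.mul_apply, ← Module.End.mul_apply, ← map_mul, ← map_mul]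
  exact congrArg (fun u => tensorAction C act u w) (one_tmul_mul_comm c z).symm

theorem rid_lTensor_eq_zero (π : C →ₗ[k] k) (y : C) (hπ : ∀ c, π (y * c) = 0) (w : A ⊗[k] C)
    (hw : (1 ⊗ₜ y) ∣ w) : TensorProduct.rid k A (LinearMap.lTensor A π w) = 0 := by
  obtain ⟨v, rfl⟩ := hw
  induction v with
  | zero => simp
  | add u v hu hv => rw [mul_add, map_add, map_add, hu, hv, add_zero]
  | tmul b c => simp [hπ]

/-- A submodule of `A ⊗ C` containing `1` and `y (A ⊗ C)`, and stable under `x`, is everything. -/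
theorem tensor_span (x : A) (y : C)
    (hA : ∀ S : Submodule k A, 1 ∈ S → (∀ a ∈ S, x * a ∈ S) → S = ⊤)
    (hC : ∀ S : Submodule k C, 1 ∈ S → (∀ c ∈ S, y * c ∈ S) → S = ⊤)
    (S : Submodule k (A ⊗[k] C)) (h1 : (1 : A ⊗[k] C) ∈ S) (hx : ∀ w ∈ S, (x ⊗ₜ 1) * w ∈ S)
    (hy : ∀ w, (1 ⊗ₜ y) * w ∈ S) : S = ⊤ := by
  have hS1 : ∀ a : A, a ⊗ₜ (1 : C) ∈ S := by
    have := hA (S.comap ((TensorProduct.mk k A C).flip 1)) h1 fun a ha => by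
      have := hx _ ha
      simpa using this
    intro a
    exact (this ▸ Submodule.mem_top : a ∈ S.comap ((TensorProduct.mk k A C).flip 1))
  have hS : ∀ (a : A) (c : C), a ⊗ₜ c ∈ S := by
    intro a
    have := hC (S.comap (TensorProduct.mk k A C a)) (hS1 a) fun c _ => by
      have := hy (a ⊗ₜ c)
      simpa using this
    intro c
    exact (this ▸ Submodule.mem_top : c ∈ S.comap (TensorProduct.mk k A C a))
  rw [eq_top_iff]
  rintro w -
  induction w with
  | zero => exact zero_mem _
  | add u v hu hv => exact add_mem (hu) (hv)
  | tmul a c => exact hS a c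

/-- An upper triangular twisting map is determined by its value at `y ⊗ x`. -/
theorem twistingMap_unique (x : A) (y : C) (n : ℕ) (hy : y ^ n = 0)
    (hA : ∀ S : Submodule k A, 1 ∈ S → (∀ a ∈ S, x * a ∈ S) → S = ⊤)
    (hC : ∀ S : Submodule k C, 1 ∈ S → (∀ c ∈ S, y * c ∈ S) → S = ⊤)
    (I : Finset ℕ) (hI : ∀ r ∈ I, 1 ≤ r) (P : ℕ → A)
    (s s' : C ⊗[k] A →ₗ[k] A ⊗[k] C) (hs : IsTwistingMap k A C s) (hs' : IsTwistingMap k A C s')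
    (hsy : ∀ a, (1 ⊗ₜ y) ∣ s (y ⊗ₜ a)) (hsy' : ∀ a, (1 ⊗ₜ y) ∣ s' (y ⊗ₜ a))
    (hsx : s (y ⊗ₜ x) = ∑ r ∈ I, P r ⊗ₜ (y ^ r)) (hsx' : s' (y ⊗ₜ x) = ∑ r ∈ I, P r ⊗ₜ (y ^ r)) :
    s = s' := by
  have hpow : ∀ s, IsTwistingMap k A C s → ∀ r w,
      (twistAction s y ^ r) w = twistAction s (y ^ r) w := by
    intro s hs r
    rw [isTwistingMap_iff] at hs
    have hmul : ∀ c c' w, twistAction s (c * c') w = twistAction s c (twistAction s c' w) := by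
      intro c c' w
      induction w with
      | zero => simp
      | add u v hu hv => simp only [map_add, hu, hv]
      | tmul a d => rw [twistAction_tmul, twistAction_tmul, twistAction_mul_right, hs.2.2.1]
    induction r with
    | zero =>
      intro w
      rw [pow_zero, pow_zero, Module.End.one_apply]
      induction w with
      | zero => simp
      | add u v hu hv => rw [map_add, ← hu, ← hv]
      | tmul a d => simp [twistAction_tmul, hs.1]
    | succ r ih =>
      intro w
      rw [pow_succ', Module.End.mul_apply, ih, pow_succ', hmul]
  have hdvd : ∀ s : C ⊗[k] A →ₗ[k] A ⊗[k] C, (∀ a, (1 ⊗ₜ y) ∣ s (y ⊗ₜ a)) →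
      ∀ w, (1 ⊗ₜ y) ∣ twistAction s y w := by
    intro s hsy w
    induction w with
    | zero => simp
    | add u v hu hv => rw [map_add]; exact dvd_add hu hv
    | tmul a d => rw [twistAction_tmul]; exact dvd_mul_of_dvd_right (hsy a) _
  have hrel : ∀ s, IsTwistingMap k A C s → s (y ⊗ₜ x) = ∑ r ∈ I, P r ⊗ₜ (y ^ r) → ∀ w,
      twistAction s y ((x ⊗ₜ 1) * w) = ∑ r ∈ I, (P r ⊗ₜ 1) * (twistAction s y ^ r) w := by
    intro s hs hsx w
    simp only [hpow s hs]
    rw [isTwistingMap_iff] at hs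
    induction w with
    | zero => simp
    | add u v hu hv => simp only [mul_add, map_add, hu, hv, Finset.sum_add_distrib]
    | tmul a d =>
      rw [Algebra.TensorProduct.tmul_mul_tmul, one_mul, twistAction_tmul, hs.2.2.2, hsx, map_sum,
        Finset.mul_sum]
      refine Finset.sum_congr rfl fun r _ => ?_
      rw [twistActionRight_tmul, twistAction_tmul]
      ring
  have hone : ∀ s, IsTwistingMap k A C s → twistAction s y 1 = 1 ⊗ₜ y := by
    intro s hs
    rw [Algebra.TensorProduct.one_def, twistAction_tmul, hs.2.1]
    simp
  have key : ∀ w, twistAction s y w = twistAction s' y w := by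
    refine map_comm_of_relation (k := k) LinearMap.id I hI (LinearMap.mulLeft k (1 ⊗ₜ y))
      (LinearMap.mulLeft k (x ⊗ₜ 1)) (twistAction s y) (fun r => LinearMap.mulLeft k (P r ⊗ₜ 1))
      (LinearMap.mulLeft k (1 ⊗ₜ y))
      (LinearMap.mulLeft k (x ⊗ₜ 1)) (twistAction s' y) (fun r => LinearMap.mulLeft k (P r ⊗ₜ 1))
      (fun N => LinearMap.range (LinearMap.mulLeft k ((1 ⊗ₜ y : A ⊗[k] C) ^ N))) n
      ?_ ?_ ?_ ?_ ?_ ?_ ?_ ?_ ?_ ?_ ?_ ?_ ?_ ?_ 1 ?_ ?_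
    · rw [eq_top_iff]
      rintro w -
      exact ⟨w, by simp⟩
    · rw [LinearMap.range_eq_bot, Algebra.TensorProduct.tmul_pow, hy]
      simp
    · rintro N _ ⟨w, rfl⟩
      exact ⟨(1 ⊗ₜ y) * w, by simp only [LinearMap.mulLeft_apply]; ring⟩
    · rintro N _ ⟨w, rfl⟩
      exact ⟨w, by simp only [LinearMap.mulLeft_apply]; ring⟩
    · rintro N _ ⟨w, rfl⟩
      obtain ⟨v, hv⟩ := hdvd s' hsy' w
      refine ⟨v, ?_⟩
      have := twistAction_mul_right s' y (y ^ N) w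
      have hp : ∀ N, (1 ⊗ₜ y : A ⊗[k] C) ^ N = 1 ⊗ₜ (y ^ N) := fun N => by
        rw [Algebra.TensorProduct.tmul_pow, one_pow]
      rw [LinearMap.mulLeft_apply, LinearMap.mulLeft_apply, hp, hp, this, hv, ← mul_assoc,
        Algebra.TensorProduct.tmul_mul_tmul, one_mul, pow_succ]
    · rintro r N _ ⟨w, rfl⟩
      exact ⟨(P r ⊗ₜ 1) * w, by simp only [LinearMap.mulLeft_apply]; ring⟩
    · exact fun w => rfl
    · exact fun w => rfl
    · exact fun r w => rfl
    · exact fun w => hdvd s hsy w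
    · exact fun w => twistAction_mul_right s y y w
    · exact fun w => twistAction_mul_right s' y y w
    · exact hrel s hs hsx
    · exact hrel s' hs' hsx'
    · exact (hone s hs).trans (hone s' hs').symm
    · exact fun S => tensor_span x y hA hC S
  have hS := hC (LinearMap.ker (TensorProduct.curry (s - s')))
    (by
      rw [LinearMap.mem_ker]
      ext a
      simp [hs.1, hs'.1]) fun c hc => by
      rw [LinearMap.mem_ker] at hc ⊢
      ext a
      have hc' : s (c ⊗ₜ a) = s' (c ⊗ₜ a) := sub_eq_zero.1 (LinearMap.congr_fun hc a)
      rw [isTwistingMap_iff] at hs hs'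
      rw [TensorProduct.curry_apply, LinearMap.sub_apply, hs.2.2.1, hs'.2.2.1, hc', key, sub_self]
      rfl
  refine TensorProduct.ext' fun c a => ?_
  have hc : c ∈ LinearMap.ker (TensorProduct.curry (s - s')) := hS ▸ Submodule.mem_top
  exact sub_eq_zero.1 (LinearMap.congr_fun hc a)

/-- Existence of an operator with prescribed commutation with `x`. -/
theorem exists_tensor_operator (act : D →ₐ[k] Module.End k A) (L : A →ₐ[k] D) (x : A) (Q : ℕ → A)
    (f : D) (hf1 : act f 1 = 1) (hfx : f * L x = L x * (L (Q 1) * f)) (S : D →ₗ[k] D)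
    (hS1 : ∀ h, act (S h) 1 = 0) (hSx : ∀ h, S h * L x = L x * (L (Q 1) * S h + h))
    (n : ℕ) (hn : 0 < n) (y : C) (hy : y ^ n = 0) :
    ∃ Γ : D ⊗[k] C, (1 ⊗ₜ y) ∣ Γ ∧
      Γ * (L x ⊗ₜ 1) = ∑ r ∈ Finset.Ico 1 (n + 1), (L (x * Q r) ⊗ₜ 1) * Γ ^ r ∧
      tensorAction C act Γ 1 = 1 ⊗ₜ y := by
  let T : D ⊗[k] C →ₗ[k] D ⊗[k] C :=
    LinearMap.rTensor C S
  have hTt : ∀ z, T ((1 ⊗ₜ y) * z) = (1 ⊗ₜ y) * T z := by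
    intro z
    induction z with
    | zero => simp
    | add u v hu hv => rw [mul_add, map_add, map_add, hu, hv, mul_add]
    | tmul d c => simp [T]
  have hT1 : ∀ z, tensorAction C act (T z) 1 = 0 := by
    intro z
    induction z with
    | zero => simp
    | add u v hu hv => rw [map_add, map_add, LinearMap.add_apply, hu, hv, add_zero]
    | tmul d c =>
      rw [Algebra.TensorProduct.one_def]
      simp [T, hS1]
  have hTx : ∀ z, T z * (L x ⊗ₜ 1) =
      (L x ⊗ₜ 1) * ((L (Q 1) ⊗ₜ 1) * T z + z) := by
    intro z
    induction z with
    | zero => simp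
    | add u v hu hv =>
      rw [map_add, add_mul, hu, hv, ← mul_add, mul_add _ (T u)]
      congr 1
      abel
    | tmul d c => simp [T, hSx, ← add_tmul]
  obtain ⟨Γ, hΓ, hfix⟩ := exists_fixed_point (E := D ⊗[k] C) (1 ⊗ₜ y)
    (one_tmul_mul_comm y) n (by rw [Algebra.TensorProduct.tmul_pow, hy, tmul_zero]) T.toAddMonoidHom
    hTt (Finset.Ico 2 (n + 1)) (fun r hr => (Finset.mem_Ico.1 hr).1)
    (fun r => L (Q r) ⊗ₜ 1) (f ⊗ₜ y) ⟨f ⊗ₜ 1, by simp⟩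
  refine ⟨Γ, hΓ, ?_, ?_⟩
  · have e : ∀ r, (L (x * Q r) ⊗ₜ[k] (1 : C)) =
        (L x ⊗ₜ 1) * (L (Q r) ⊗ₜ 1) := by
      intro r
      rw [map_mul, Algebra.TensorProduct.tmul_mul_tmul, one_mul]
    have hsum : ∀ z, ∑ r ∈ Finset.Ico 2 (n + 1),
        (L (Q r) ⊗ₜ[k] (1 : C)) * Γ ^ r = z → Γ = f ⊗ₜ y + T z →
        Γ * (L x ⊗ₜ 1) = (L x ⊗ₜ 1) *
          ((L (Q 1) ⊗ₜ 1) * Γ + z) := by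
      intro z _ hz
      rw [hz, add_mul, hTx, mul_add _ (f ⊗ₜ y), add_assoc, mul_add _ (_ * f ⊗ₜ[k] y)]
      congr 1
      simp [hfx]
    rw [hsum _ rfl hfix, Finset.sum_eq_sum_Ico_succ_bot (a := 1) (by omega), mul_add, pow_one, e,
      mul_assoc, Finset.mul_sum]
    simp only [e, mul_assoc]
  · rw [hfix, map_add, LinearMap.add_apply]
    change _ + tensorAction C act (T _) 1 = _
    rw [hT1, Algebra.TensorProduct.one_def]
    simp [hf1]

/-- Existence of the twisting map from an operator on `A ⊗ C`. -/
theorem exists_twistingMap (act : D →ₐ[k] Module.End k A) (M : A →ₐ[k] D)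
    (hM : ∀ a b, act (M a) b = a * b) (x : A) (y : C) (n : ℕ) (hy : y ^ n = 0)
    (hA : ∀ S : Submodule k A, 1 ∈ S → (∀ a ∈ S, x * a ∈ S) → S = ⊤)
    (hC : ∀ S : Submodule k C, 1 ∈ S → (∀ c ∈ S, y * c ∈ S) → S = ⊤)
    (I : Finset ℕ) (hI : ∀ r ∈ I, 1 ≤ r) (P : ℕ → A) (Γ : D ⊗[k] C)
    (hΓ : (1 ⊗ₜ y) ∣ Γ)
    (hrel : Γ * (M x ⊗ₜ 1) = ∑ r ∈ I, (M (P r) ⊗ₜ 1) * Γ ^ r)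
    (hone : tensorAction C act Γ 1 = 1 ⊗ₜ y)
    (ψ : C →ₐ[k] D ⊗[k] C) (hψ : ψ y = Γ) :
    ∃ s : C ⊗[k] A →ₗ[k] A ⊗[k] C, IsTwistingMap k A C s ∧ (∀ a, (1 ⊗ₜ y) ∣ s (y ⊗ₜ a)) ∧
      s (y ⊗ₜ x) = ∑ r ∈ I, P r ⊗ₜ (y ^ r) := by
  let ρ := tensorAction C act
  let L : A →ₐ[k] D ⊗[k] C :=
    Algebra.TensorProduct.includeLeft.comp (M)
  have hL : ∀ a, L a = M a ⊗ₜ 1 := fun a => rfl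
  have hρL : ∀ a w, ρ (L a) w = (a ⊗ₜ 1) * w := by
    intro a w
    induction w with
    | zero => simp
    | add u v hu hv => rw [map_add, hu, hv, mul_add]
    | tmul e d => simp [ρ, hL, hM]
  have hρt : ∀ c w, ρ (1 ⊗ₜ c) w = (1 ⊗ₜ c) * w := by
    intro c w
    induction w with
    | zero => simp
    | add u v hu hv => rw [map_add, hu, hv, mul_add]
    | tmul e d => simp [ρ]
  let θ : A ⊗[k] C →ₗ[k] D ⊗[k] C :=
    TensorProduct.lift ((LinearMap.mul k _).compl₁₂ L.toLinearMap ψ.toLinearMap)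
  have hθ : ∀ a c, θ (a ⊗ₜ c) = L a * ψ c := fun a c => rfl
  have hθL : ∀ a w, θ ((a ⊗ₜ 1) * w) = L a * θ w := by
    intro a w
    induction w with
    | zero => simp
    | add u v hu hv => rw [mul_add, map_add, map_add, hu, hv, mul_add]
    | tmul e d =>
      rw [Algebra.TensorProduct.tmul_mul_tmul, one_mul, hθ, hθ, map_mul, mul_assoc]
  have hθt : ∀ w, θ ((1 ⊗ₜ y) * w) = θ w * Γ := by
    intro w
    induction w with
    | zero => simp
    | add u v hu hv => rw [mul_add, map_add, map_add, hu, hv, add_mul]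
    | tmul e d =>
      rw [Algebra.TensorProduct.tmul_mul_tmul, one_mul, hθ, hθ, mul_comm y, map_mul, mul_assoc, hψ]
  have htc : ∀ N (z : D ⊗[k] C), (1 ⊗ₜ y) ^ N * z = z * (1 ⊗ₜ y) ^ N := fun N z =>
    (Commute.pow_left (one_tmul_mul_comm y z) N).eq
  have hρrel : ∀ w, ρ Γ ((x ⊗ₜ 1) * w) = ∑ r ∈ I, (P r ⊗ₜ 1) * (ρ Γ ^ r) w := by
    intro w
    rw [← hρL, ← Module.End.mul_apply, ← map_mul, hL, hrel, map_sum, LinearMap.sum_apply]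
    refine Finset.sum_congr rfl fun r _ => ?_
    rw [← hL, map_mul, map_pow, Module.End.mul_apply, hρL]
  have hθΓ : ∀ w, θ (ρ Γ w) = Γ * θ w := by
    obtain ⟨G, hG⟩ := hΓ
    refine map_comm_of_relation (k := k) θ I hI (LinearMap.mulLeft k (1 ⊗ₜ y))
      (LinearMap.mulLeft k (x ⊗ₜ 1)) (ρ Γ) (fun r => LinearMap.mulLeft k (P r ⊗ₜ 1))
      (LinearMap.mulRight k Γ) (LinearMap.mulLeft k (L x)) (LinearMap.mulLeft k Γ)
      (fun r => LinearMap.mulLeft k (L (P r)))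
      (fun N => LinearMap.range
        (LinearMap.mulLeft k ((1 ⊗ₜ y : D ⊗[k] C) ^ N))) n
      ?_ ?_ ?_ ?_ ?_ ?_ ?_ ?_ ?_ ?_ ?_ ?_ ?_ ?_ 1 ?_ ?_
    · rw [eq_top_iff]
      rintro w -
      exact ⟨w, by simp⟩
    · rw [LinearMap.range_eq_bot, Algebra.TensorProduct.tmul_pow, hy]
      simp
    · rintro N _ ⟨w, rfl⟩
      exact ⟨(1 ⊗ₜ y) * w, by
        rw [LinearMap.mulLeft_apply, LinearMap.mulLeft_apply, pow_succ, mul_assoc]⟩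
    · rintro N _ ⟨w, rfl⟩
      refine ⟨w * G, ?_⟩
      rw [LinearMap.mulLeft_apply, LinearMap.mulLeft_apply, LinearMap.mulRight_apply, hG,
        one_tmul_mul_comm, pow_succ, mul_assoc, mul_assoc, one_tmul_mul_comm y (w * G), mul_assoc]
    · rintro N _ ⟨w, rfl⟩
      refine ⟨G * w, ?_⟩
      rw [LinearMap.mulLeft_apply, LinearMap.mulLeft_apply, LinearMap.mulLeft_apply, hG,
        pow_succ', mul_assoc, mul_assoc, ← mul_assoc G, ← htc, mul_assoc]
    · rintro r N _ ⟨w, rfl⟩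
      refine ⟨L (P r) * w, ?_⟩
      rw [LinearMap.mulLeft_apply, LinearMap.mulLeft_apply, LinearMap.mulLeft_apply, ← mul_assoc,
        htc, mul_assoc]
    · exact hθt
    · exact hθL x
    · exact fun r w => hθL (P r) w
    · intro w
      exact ⟨ρ G w, by rw [hG, map_mul, Module.End.mul_apply, hρt, LinearMap.mulLeft_apply]⟩
    · exact fun w => tensorAction_mul_right act Γ y w
    · exact fun w => (mul_assoc _ _ _).symm
    · exact hρrel
    · intro w
      simp only [LinearMap.mulLeft_apply, LinearMap.pow_mulLeft, ← mul_assoc]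
      rw [← Finset.sum_mul]
      exact congrArg (· * w) hrel
    · have h1 : θ 1 = 1 := by
        rw [Algebra.TensorProduct.one_def, hθ, map_one, map_one, one_mul]
      rw [h1, hone, hθ, map_one, one_mul, hψ, LinearMap.mulLeft_apply, mul_one]
    · exact fun S => tensor_span x y hA hC S
  have hθψ : ∀ c w, θ (ρ (ψ c) w) = ψ c * θ w := by
    intro c
    let S : Submodule k C := LinearMap.ker
      (((LinearMap.llcomp k _ _ _ θ) ∘ₗ ρ.toLinearMap -
        (LinearMap.lcomp k _ θ) ∘ₗ LinearMap.mul k _) ∘ₗ ψ.toLinearMap)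
    have hS : ∀ c, c ∈ S ↔ ∀ w, θ (ρ (ψ c) w) = ψ c * θ w := by
      intro c
      rw [LinearMap.mem_ker, LinearMap.ext_iff]
      exact forall_congr' fun w => sub_eq_zero
    have hST : S = ⊤ := by
      refine hC S ((hS 1).2 fun w => by simp) fun c hc => (hS _).2 fun w => ?_
      rw [map_mul, map_mul, Module.End.mul_apply, hψ, hθΓ, (hS c).1 hc, mul_assoc]
    exact (hS c).1 (hST ▸ Submodule.mem_top)
  let s : C ⊗[k] A →ₗ[k] A ⊗[k] C := TensorProduct.lift
    (LinearMap.lcomp k _ ((TensorProduct.mk k A C).flip 1) ∘ₗ ρ.toLinearMap ∘ₗ ψ.toLinearMap)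
  have hs : ∀ c a, s (c ⊗ₜ a) = ρ (ψ c) (a ⊗ₜ 1) := fun c a => rfl
  have htw : ∀ c w, twistAction s c w = ρ (ψ c) w := by
    intro c w
    induction w with
    | zero => simp
    | add u v hu hv => rw [map_add, map_add, hu, hv]
    | tmul a d =>
      rw [twistAction_tmul, hs, ← tensorAction_mul_right, Algebra.TensorProduct.tmul_mul_tmul,
        one_mul, mul_one]
  have htr : ∀ a w, twistActionRight s a w = ρ (θ w) (a ⊗ₜ 1) := by
    intro a w
    induction w with
    | zero => simp
    | add u v hu hv => rw [map_add, map_add, map_add, LinearMap.add_apply, hu, hv]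
    | tmul b d => rw [twistActionRight_tmul, hs, hθ, map_mul, Module.End.mul_apply, hρL]
  have hs1 : ∀ c, ρ (ψ c) 1 = 1 ⊗ₜ c := by
    intro c
    have := hC (LinearMap.eqLocus (LinearMap.applyₗ (1 : A ⊗[k] C) ∘ₗ ρ.toLinearMap ∘ₗ
      ψ.toLinearMap) (TensorProduct.mk k A C 1))
      (by
        change ρ (ψ 1) 1 = 1 ⊗ₜ 1
        rw [map_one ψ, map_one ρ, Module.End.one_apply, Algebra.TensorProduct.one_def])
      fun c hc => by
        change ρ (ψ c) 1 = 1 ⊗ₜ c at hc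
        change ρ (ψ (y * c)) 1 = 1 ⊗ₜ (y * c)
        rw [map_mul, map_mul, Module.End.mul_apply, hc, hψ, ← mul_one (1 ⊗ₜ c),
          tensorAction_mul_right, hone, Algebra.TensorProduct.tmul_mul_tmul, one_mul, mul_comm]
    exact (this ▸ Submodule.mem_top : c ∈ LinearMap.eqLocus _ _)
  refine ⟨s, (isTwistingMap_iff s).2 ⟨fun a => ?_, hs1, fun c c' a => ?_, fun c a a' => ?_⟩,
    fun a => ?_, ?_⟩
  · rw [hs, map_one, map_one, Module.End.one_apply]
  · rw [htw, hs, hs, map_mul, map_mul, Module.End.mul_apply]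
  · rw [htr, hs, hs, hθψ, hθ, map_one, mul_one, map_mul, Module.End.mul_apply, hρL,
      Algebra.TensorProduct.tmul_mul_tmul, one_mul]
  · obtain ⟨G, hG⟩ := hΓ
    exact ⟨ρ G (a ⊗ₜ 1), by rw [hs, hψ, hG, map_mul, Module.End.mul_apply, hρt]⟩
  · have := hρrel 1
    rw [mul_one] at this
    rw [hs, hψ, this]
    refine Finset.sum_congr rfl fun r _ => ?_
    rw [← map_pow, ← hψ, ← map_pow, hs1, Algebra.TensorProduct.tmul_mul_tmul, mul_one, one_mul]

theorem exists_twistingMap_of_lift (act : D →ₐ[k] Module.End k A) (L : A →ₐ[k] D)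
    (hL : ∀ a b, act (L a) b = a * b) (x : A)
    (hA : ∀ S : Submodule k A, 1 ∈ S → (∀ a ∈ S, x * a ∈ S) → S = ⊤) (Q : ℕ → A)
    (f : D) (hf1 : act f 1 = 1) (hfx : f * L x = L x * (L (Q 1) * f)) (S : D →ₗ[k] D)
    (hS1 : ∀ h, act (S h) 1 = 0) (hSx : ∀ h, S h * L x = L x * (L (Q 1) * S h + h))
    (n : ℕ) (hn : 0 < n) (y : C) (hy : y ^ n = 0)
    (hC : ∀ S : Submodule k C, 1 ∈ S → (∀ c ∈ S, y * c ∈ S) → S = ⊤)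
    (hlift : ∀ Γ : D ⊗[k] C, Γ ^ n = 0 → ∃ ψ : C →ₐ[k] D ⊗[k] C, ψ y = Γ) :
    ∃ s : C ⊗[k] A →ₗ[k] A ⊗[k] C, IsTwistingMap k A C s ∧ (∀ a, (1 ⊗ₜ y) ∣ s (y ⊗ₜ a)) ∧
      s (y ⊗ₜ x) = ∑ r ∈ Finset.Ico 1 (n + 1), (x * Q r) ⊗ₜ (y ^ r) := by
  obtain ⟨Γ, hΓ, hrel, hone⟩ := exists_tensor_operator act L x Q f hf1 hfx S hS1 hSx n hn y hy
  have hΓn : Γ ^ n = 0 := by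
    obtain ⟨G, rfl⟩ := hΓ
    rw [Commute.mul_pow (one_tmul_mul_comm y G), Algebra.TensorProduct.tmul_pow, hy, tmul_zero,
      zero_mul]
  obtain ⟨ψ, hψ⟩ := hlift Γ hΓn
  exact exists_twistingMap act L hL x y n hy hA hC (Finset.Ico 1 (n + 1))
    (fun r hr => (Finset.mem_Ico.1 hr).1) (fun r => x * Q r) Γ hΓ hrel hone ψ hψ

end

theorem exists_twistingMap_truncPoly (k : Type*) [CommRing k] (m n : ℕ) (hn : 0 < n)
    (Q : ℕ → TruncPoly k m) :
    ∃ s : TruncPoly k n ⊗[k] TruncPoly k m →ₗ[k] TruncPoly k m ⊗[k] TruncPoly k n,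
      IsTwistingMap k (TruncPoly k m) (TruncPoly k n) s ∧
      (∀ a, (1 ⊗ₜ truncY k n) ∣ s (truncY k n ⊗ₜ a)) ∧
      s (truncY k n ⊗ₜ truncY k m) =
        ∑ r ∈ Finset.Ico 1 (n + 1), (truncY k m * Q r) ⊗ₜ (truncY k n ^ r) := by
  obtain ⟨f, hf1, hfx⟩ := exists_filteredEnd k m (Q 1) 1 0
  obtain ⟨S, hS1, hSx⟩ := exists_linear_filteredEnd k m (Q 1)
  have hfx' : f * mulFiltered k _ (truncY k m) =
      mulFiltered k _ (truncY k m) * (mulFiltered k _ (Q 1) * f) := by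
    refine Subtype.ext (LinearMap.ext fun b => ?_)
    simpa using hfx b
  exact exists_twistingMap_of_lift (filteredEnd k (truncY k m)).val (mulFiltered k (truncY k m))
    (fun _ _ => rfl) (truncY k m) (truncPoly_induction k m) Q f hf1 hfx' S hS1 hSx n hn
    (truncY k n) (truncY_pow k n) (truncPoly_induction k n)
    (fun Γ hΓ => exists_algHom_truncPoly (k := k) n Γ hΓ)

/-- Upper triangularity in terms of divisibility. -/
theorem exists_components_iff {k A : Type*} [CommRing k] [CommRing A] [Algebra k A] (n : ℕ)
    (hn : 0 < n) (x : A) (P : ℕ → A) (s : TruncPoly k n ⊗[k] A →ₗ[k] A ⊗[k] TruncPoly k n) :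
    (∃ γ : ℕ → ℕ → Module.End k A,
      (∀ r < n, ∀ a : A, s ((truncY k n ^ r) ⊗ₜ[k] a) =
        ∑ j ∈ Finset.range n, γ r j a ⊗ₜ[k] (truncY k n ^ j)) ∧
      γ 1 0 = 0 ∧ ∀ j, 1 ≤ j → j < n → γ 1 j x = P j) ↔
    (∀ a, (1 ⊗ₜ truncY k n) ∣ s (truncY k n ⊗ₜ a)) ∧
      s (truncY k n ⊗ₜ x) = ∑ j ∈ Finset.Ico 1 n, P j ⊗ₜ (truncY k n ^ j) := by
  constructor
  · rintro ⟨γ, hγ, hγ0, hγx⟩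
    have h : ∀ a, s (truncY k n ⊗ₜ a) =
        ∑ j ∈ Finset.Ico 1 n, γ 1 j a ⊗ₜ[k] (truncY k n ^ j) := by
      intro a
      rcases Nat.lt_or_ge 1 n with h1 | h1
      · have := hγ 1 h1 a
        rwa [pow_one, Finset.range_eq_Ico, Finset.sum_eq_sum_Ico_succ_bot hn, hγ0,
          LinearMap.zero_apply, zero_tmul, zero_add] at this
      · obtain rfl : n = 1 := by omega
        have hy : truncY k 1 = 0 := by rw [← pow_one (truncY k 1), truncY_pow]
        rw [hy, zero_tmul, map_zero, Finset.Ico_self, Finset.sum_empty]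
    refine ⟨fun a => ?_, ?_⟩
    · rw [h]
      refine Finset.dvd_sum fun j hj => ⟨γ 1 j a ⊗ₜ[k] (truncY k n ^ (j - 1)), ?_⟩
      rw [Algebra.TensorProduct.tmul_mul_tmul, one_mul, ← pow_succ',
        Nat.sub_add_cancel (Finset.mem_Ico.1 hj).1]
    · rw [h]
      refine Finset.sum_congr rfl fun j hj => ?_
      rw [hγx j (Finset.mem_Ico.1 hj).1 (Finset.mem_Ico.1 hj).2]
  · rintro ⟨hdvd, hx⟩
    obtain ⟨π, hπ, hsum⟩ := exists_truncPoly_coeff k n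
    let κ : ℕ → A ⊗[k] TruncPoly k n →ₗ[k] A := fun j =>
      (TensorProduct.rid k A).toLinearMap ∘ₗ LinearMap.lTensor A (π j)
    have hκ : ∀ j a c, κ j (a ⊗ₜ c) = π j c • a := fun j a c => by simp [κ]
    have hexp : ∀ w, w = ∑ j ∈ Finset.range n, κ j w ⊗ₜ[k] (truncY k n ^ j) := by
      intro w
      induction w with
      | zero => simp
      | add u v hu hv =>
        simp only [map_add, add_tmul, Finset.sum_add_distrib]
        rw [← hu, ← hv]
      | tmul a c =>
        simp only [hκ, smul_tmul]
        rw [← tmul_sum, hsum]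
    have hπ0 : ∀ c, π 0 (truncY k n * c) = 0 := by
      intro c
      rw [← hsum c, Finset.mul_sum, map_sum]
      refine Finset.sum_eq_zero fun j _ => ?_
      rw [mul_smul_comm, map_smul, ← pow_succ', hπ 0 hn, if_neg (by omega), smul_zero]
    refine ⟨fun r j => κ j ∘ₗ s ∘ₗ TensorProduct.mk k (TruncPoly k n) A (truncY k n ^ r),
      fun r _ a => hexp _, ?_, fun j hj hjn => ?_⟩
    · refine LinearMap.ext fun a => ?_
      change κ 0 (s ((truncY k n ^ 1) ⊗ₜ a)) = 0
      rw [pow_one]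
      exact rid_lTensor_eq_zero (π 0) (truncY k n) hπ0 _ (hdvd a)
    · change κ j (s ((truncY k n ^ 1) ⊗ₜ x)) = P j
      rw [pow_one, hx, map_sum, Finset.sum_eq_single j]
      · rw [hκ, hπ j hjn, if_pos rfl, one_smul]
      · intro i _ hij
        rw [hκ, hπ j hjn, if_neg hij, zero_smul]
      · exact fun h => absurd (Finset.mem_Ico.2 ⟨hj, hjn⟩) h

/-- Let `A := k[x]/⟨x^m⟩` and let `P_1, …, P_{n-1} ∈ A` be divisible by `x`. Then
there exists a unique upper triangular twisting map
`s_n : k[y]/⟨y^n⟩ ⊗ A → A ⊗ k[y]/⟨y^n⟩` (i.e. with `γ^1_0 = 0`) such that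
`γ^1_j(x) = P_j` for `j = 1, …, n-1`. -/
theorem statement19 (k : Type*) [CommRing k] (m n : ℕ) (hm : 0 < m) (hn : 0 < n)
    (P : ℕ → TruncPoly k m)
    (hP : ∀ j, 1 ≤ j → j < n → truncY k m ∣ P j) :
    ∃! s : TruncPoly k n ⊗[k] (TruncPoly k m) →ₗ[k] (TruncPoly k m) ⊗[k] TruncPoly k n,
      IsTwistingMap k (TruncPoly k m) (TruncPoly k n) s ∧
      ∃ γ : ℕ → ℕ → Module.End k (TruncPoly k m),
        (∀ r < n, ∀ a : TruncPoly k m,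
          s (((truncY k n) ^ r) ⊗ₜ[k] a) =
            ∑ j ∈ Finset.range n, γ r j a ⊗ₜ[k] ((truncY k n) ^ j)) ∧
        γ 1 0 = 0 ∧
        (∀ j, 1 ≤ j → j < n → γ 1 j (truncY k m) = P j) := by
  have hQ : ∀ j, ∃ q, 1 ≤ j → j < n → P j = truncY k m * q := by
    intro j
    by_cases h : 1 ≤ j ∧ j < n
    · obtain ⟨q, hq⟩ := hP j h.1 h.2
      exact ⟨q, fun _ _ => hq⟩
    · exact ⟨0, fun h1 h2 => absurd ⟨h1, h2⟩ h⟩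
  choose Q hQ using hQ
  simp only [exists_components_iff n hn (truncY k m) P]
  obtain ⟨s, hs, hdvd, hx⟩ := exists_twistingMap_truncPoly k m n hn Q
  have hx' : s (truncY k n ⊗ₜ truncY k m) =
      ∑ j ∈ Finset.Ico 1 n, P j ⊗ₜ (truncY k n ^ j) := by
    rw [hx, Finset.sum_Ico_succ_top hn, truncY_pow, tmul_zero, add_zero]
    refine Finset.sum_congr rfl fun j hj => ?_
    rw [hQ j (Finset.mem_Ico.1 hj).1 (Finset.mem_Ico.1 hj).2]
  refine ⟨s, ⟨hs, hdvd, hx'⟩, ?_⟩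
  rintro s' ⟨hs', hdvd', hxs'⟩
  exact twistingMap_unique (truncY k m) (truncY k n) n (truncY_pow k n)
    (truncPoly_induction k m) (truncPoly_induction k n) (Finset.Ico 1 n)
    (fun r hr => (Finset.mem_Ico.1 hr).1) P s' s hs' hs hdvd' hdvd hxs' hx'
end
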